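/- arXiv:0810.4752 — 5 statements merged into one kernel-verified Lean document; each statement's English description precedes it below -/
import Mathlib

section
/- Let F be a finite class of classifiers and, for each n, let f_n be an empirical risk minimizer over F for the i.i.d. n-sample. Then empirical risk minimization over F is consistent with respect to F for every probability distribution P on 𝒳 × 𝒴: for every P and every ε > 0, Pr(R(f_n) − inf_{f ∈ F} R(f) > ε) → 0 as n → ∞. -/
open MeasureTheory Filter

/-- The risk of a classifier under the 0-1 loss. Labels `{−1,+1}` are encoded as `Bool`. -/
noncomputable def risk {X : Type*} [MeasurableSpace X] (P : Measure (X × Bool))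
    (f : X → Bool) : ℝ :=
  (P {p | f p.1 ≠ p.2}).toReal

/-- The empirical risk of a classifier on a sample of `n` labeled points. -/
noncomputable def empRisk {X : Type*} {n : ℕ} (f : X → Bool) (s : Fin n → X × Bool) : ℝ :=
  ((Finset.univ.filter fun i => f (s i).1 ≠ (s i).2).card : ℝ) / n

/-- The empirical risk is the average of the 0-1 losses at the sample points. -/
lemma empRisk_eq_sum_indicator {X : Type*} {n : ℕ} (f : X → Bool) (s : Fin n → X × Bool) :
    empRisk f s = (n : ℝ)⁻¹ * ∑ i, {p : X × Bool | f p.1 ≠ p.2}.indicator 1 (s i) := by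
  rw [empRisk, Finset.natCast_card_filter, div_eq_inv_mul]
  simp [Set.indicator_apply]

lemma measurableSet_misclassified {X : Type*} [MeasurableSpace X] {f : X → Bool}
    (hf : Measurable f) : MeasurableSet {p : X × Bool | f p.1 ≠ p.2} :=
  (measurableSet_eq_fun (hf.comp measurable_fst) measurable_snd).compl

/-- Chebyshev's inequality for the empirical risk of a fixed classifier. -/
lemma measure_le_abs_empRisk_sub_risk_le {X : Type*} [MeasurableSpace X]
    (P : Measure (X × Bool)) [IsProbabilityMeasure P] {f : X → Bool} (hf : Measurable f)
    {n : ℕ} (hn : n ≠ 0) {δ : ℝ} (hδ : 0 < δ) :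
    (Measure.pi fun _ : Fin n => P) {s | δ ≤ |empRisk f s - risk P f|} ≤
      ENNReal.ofReal ((4 * δ ^ 2)⁻¹ / n) := by
  have hn' : (n : ℝ) ≠ 0 := Nat.cast_ne_zero.mpr hn
  have hmeas := measurableSet_misclassified hf
  set A := {p : X × Bool | f p.1 ≠ p.2}
  have hloss : Measurable (A.indicator (1 : X × Bool → ℝ)) := measurable_one.indicator hmeas
  have hmem : MemLp (A.indicator (1 : X × Bool → ℝ)) 2 P :=
    memLp_indicator_const 2 hmeas 1 (Or.inr (measure_ne_top _ _))
  have heval (i : Fin n) : MeasurePreserving (Function.eval i) (Measure.pi fun _ => P) P :=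
    measurePreserving_eval (fun _ => P) i
  have hmem_eval (i : Fin n) :
      MemLp (fun s : Fin n → X × Bool => A.indicator (1 : X × Bool → ℝ) (s i)) 2
        (Measure.pi fun _ => P) := hmem.comp_measurePreserving (heval i)
  have hemp : (fun s : Fin n → X × Bool => empRisk f s) =
      fun s => (n : ℝ)⁻¹ * (∑ i, fun s : Fin n → X × Bool => A.indicator 1 (s i)) s := by
    ext s
    rw [empRisk_eq_sum_indicator, Finset.sum_apply]
  have hmean : ∫ s, empRisk f s ∂(Measure.pi fun _ : Fin n => P) = risk P f := by
    have hint (i : Fin n) :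
        ∫ s, A.indicator (1 : X × Bool → ℝ) (s i) ∂(Measure.pi fun _ => P) = risk P f := by
      rw [integral_comp_eval hloss.aestronglyMeasurable, integral_indicator_one hmeas]
      rfl
    rw [hemp, integral_const_mul]
    simp only [Finset.sum_apply]
    rw [integral_finsetSum _ fun i _ => (hmem_eval i).integrable (by norm_num)]
    simp [hint, hn']
  have hvar : ProbabilityTheory.variance (fun s => empRisk f s)
      (Measure.pi fun _ : Fin n => P) ≤ 4⁻¹ / n := by
    have hbound : ProbabilityTheory.variance (A.indicator (1 : X × Bool → ℝ)) P ≤ 4⁻¹ := by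
      refine (ProbabilityTheory.variance_le_sq_of_bounded (a := 0) (b := 1)
        (ae_of_all _ fun p => ?_) hloss.aemeasurable).trans (by norm_num)
      by_cases hp : p ∈ A <;> simp [hp]
    rw [hemp, ProbabilityTheory.variance_const_mul,
      ProbabilityTheory.variance_sum_pi fun _ => hmem]
    calc _ = ProbabilityTheory.variance (A.indicator (1 : X × Bool → ℝ)) P / n := by
            simp; field_simp
      _ ≤ _ := by gcongr
  have hmem_emp : MemLp (fun s => empRisk f s) 2 (Measure.pi fun _ : Fin n => P) := by
    rw [hemp]
    exact (memLp_finsetSum' _ fun i _ => hmem_eval i).const_mul _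
  have hcheb := ProbabilityTheory.meas_ge_le_variance_div_sq hmem_emp hδ
  rw [hmean] at hcheb
  refine hcheb.trans (ENNReal.ofReal_le_ofReal ?_)
  calc _ ≤ 4⁻¹ / n / δ ^ 2 := by gcongr
    _ = _ := by field_simp

/-- If an empirical risk minimizer has excess risk above `ε`, then some classifier in the class has
empirical risk at least `ε / 2` away from its risk. -/
lemma exists_le_abs_empRisk_sub_risk {X : Type*} [MeasurableSpace X] {P : Measure (X × Bool)}
    {F : Finset (X → Bool)} {n : ℕ} {s : Fin n → X × Bool} {g : X → Bool} (hg : g ∈ F)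
    (herm : ∀ f ∈ F, empRisk g s ≤ empRisk f s) {ε : ℝ}
    (hε : ε < risk P g - ⨅ f : F, risk P f) :
    ∃ f ∈ F, ε / 2 ≤ |empRisk f s - risk P f| := by
  by_contra! h
  have : Nonempty F := ⟨⟨g, hg⟩⟩
  have hinf : risk P g - ε ≤ ⨅ f : F, risk P f := le_ciInf fun f => by
    linarith [abs_lt.mp (h g hg), abs_lt.mp (h f f.2), herm f f.2]
  linarith

/-- **Consistency of ERM over a finite class.** Let `F` be a finite class of classifiers and,
for each `n`, let `f_n` be an empirical risk minimizer over `F` for the i.i.d. `n`-sample.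
Then for every probability distribution `P` on `𝒳 × 𝒴` and every `ε > 0`,
`Pr(R(f_n) − inf_{f ∈ F} R(f) > ε) → 0` as `n → ∞`. -/
theorem finite_class_erm_consistent {X : Type*} [MeasurableSpace X]
    (F : Finset (X → Bool)) (hFmeas : ∀ f ∈ F, Measurable f)
    (fn : ∀ n : ℕ, (Fin n → X × Bool) → (X → Bool))
    (hfn : ∀ n s, fn n s ∈ F)
    (hfnerm : ∀ n s, ∀ f ∈ F, empRisk (fn n s) s ≤ empRisk f s)
    (P : Measure (X × Bool)) (hP : IsProbabilityMeasure P) (ε : ℝ) (hε : 0 < ε) :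
    Tendsto (fun n : ℕ =>
        ((Measure.pi fun _ : Fin n => P)
          {s | ε < risk P (fn n s) - ⨅ f : F, risk P f}).toReal)
      atTop (nhds 0) := by
  have hlim : Tendsto (fun n : ℕ => ∑ _f ∈ F, ENNReal.ofReal ((4 * (ε / 2) ^ 2)⁻¹ / n))
      atTop (nhds 0) := by
    have h := ENNReal.tendsto_ofReal (tendsto_const_div_atTop_nhds_zero_nat (4 * (ε / 2) ^ 2)⁻¹)
    simpa using tendsto_finsetSum F fun _ _ => h
  have hbound : ∀ᶠ n : ℕ in atTop,
      (Measure.pi fun _ : Fin n => P) {s | ε < risk P (fn n s) - ⨅ f : F, risk P f} ≤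
        ∑ _f ∈ F, ENNReal.ofReal ((4 * (ε / 2) ^ 2)⁻¹ / n) := by
    filter_upwards [eventually_ne_atTop 0] with n hn
    calc _ ≤ (Measure.pi fun _ : Fin n => P)
            (⋃ f ∈ F, {s | ε / 2 ≤ |empRisk f s - risk P f|}) := by
          refine measure_mono fun s hs => ?_
          simpa using exists_le_abs_empRisk_sub_risk (hfn n s) (hfnerm n s) hs
      _ ≤ ∑ f ∈ F, _ := measure_biUnion_finset_le _ _
      _ ≤ _ := Finset.sum_le_sum fun f hf =>
          measure_le_abs_empRisk_sub_risk_le P (hFmeas f hf) hn (half_pos hε)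
  have h := tendsto_of_tendsto_of_tendsto_of_le_of_le' tendsto_const_nhds hlim
    (Eventually.of_forall fun _ => zero_le) hbound
  simpa [Function.comp_def] using (ENNReal.tendsto_toReal ENNReal.zero_ne_top).comp h
end

section
/- Let F be a countable class of classifiers. Then for every ε > 0 with nε² ≥ 2, Pr(sup_{f ∈ F} |R(f) − R_emp(f)| > ε) ≤ 2·N(F, 2n)·exp(−nε²/4), where the probability is over the i.i.d. n-sample from P. -/
open MeasureTheory

/-- The shattering coefficient `N(F, m)`: the maximum, over all choices of `m` points in `𝒳`,
of the number of distinct label vectors that functions of `F` realize on these points. -/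
noncomputable def shatterCoeff {X : Type*} (F : Set (X → Bool)) (m : ℕ) : ℕ :=
  sSup {k : ℕ | ∃ x : Fin m → X,
    k = Set.ncard {v : Fin m → Bool | ∃ f ∈ F, ∀ i, f (x i) = v i}}

open ProbabilityTheory

section Hoeffding

/-- Two-sided Hoeffding inequality for independent coordinates of a finite product measure. -/
lemma measureReal_pi_abs_sum_gt_le {n : ℕ} {Ω : Type*} [MeasurableSpace Ω] (Q : Measure Ω)
    [IsProbabilityMeasure Q] {g : Fin n → Ω → ℝ} {a b t : ℝ} (hg : ∀ i, Measurable (g i))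
    (hab : ∀ i ω, g i ω ∈ Set.Icc a b) (h0 : ∀ i, ∫ ω, g i ω ∂Q = 0) (ht : 0 ≤ t) :
    (Measure.pi fun _ : Fin n => Q).real {ω | t < |∑ i, g i (ω i)|}
      ≤ 2 * Real.exp (-t ^ 2 / (2 * (n * ((b - a) / 2) ^ 2))) := by
  set μ := Measure.pi fun _ : Fin n => Q
  have hind : iIndepFun (fun i (ω : Fin n → Ω) => g i (ω i)) μ :=
    iIndepFun_pi fun i => (hg i).aemeasurable
  have hsub (i : Fin n) :
      HasSubgaussianMGF (fun ω : Fin n → Ω => g i (ω i)) ((‖b - a‖₊ / 2) ^ 2) μ := by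
    refine hasSubgaussianMGF_of_mem_Icc_of_integral_eq_zero
      ((hg i).comp (measurable_pi_apply i)).aemeasurable (ae_of_all _ fun ω => hab i _) ?_
    rw [← h0 i]
    exact integral_comp_eval (μ := fun _ : Fin n => Q) (hg i).aestronglyMeasurable
  have hsum := HasSubgaussianMGF.sum_of_iIndepFun hind (s := Finset.univ) fun i _ => hsub i
  have hc : ((∑ _i : Fin n, (‖b - a‖₊ / 2) ^ 2 : NNReal) : ℝ) = n * ((b - a) / 2) ^ 2 := by
    simp [div_pow]
  have h1 := hsum.measure_ge_le ht
  have h2 := hsum.neg.measure_ge_le ht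
  rw [hc] at h1 h2
  calc μ.real {ω | t < |∑ i, g i (ω i)|}
      ≤ μ.real ({ω | t ≤ ∑ i, g i (ω i)} ∪ {ω | t ≤ (-fun ω => ∑ i, g i (ω i)) ω}) := by
        refine measureReal_mono fun ω (hω : t < _) => ?_
        rcases lt_abs.mp hω with h | h
        · exact Or.inl h.le
        · exact Or.inr h.le
    _ ≤ _ := (measureReal_union_le _ _).trans (by linarith)

end Hoeffding

section Shattering

variable {X : Type*}

/-- Distinct functions in a finite family are separated by fewer points than there are functions. -/
lemma exists_finset_card_lt_separating (S : Finset (X → Bool)) (hS : S.Nonempty) :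
    ∃ T : Finset X, T.card < S.card ∧ ∀ f ∈ S, ∀ g ∈ S, (∀ x ∈ T, f x = g x) → f = g := by
  classical
  induction hS using Finset.Nonempty.cons_induction with
  | singleton f => exact ⟨∅, by simp, by simp⟩
  | cons f S hf hS ih =>
    obtain ⟨T, hT, hsep⟩ := ih
    by_cases h : ∃ g ∈ S, ∀ x ∈ T, f x = g x
    · obtain ⟨g, hg, hfg⟩ := h
      have hne : f ≠ g := fun h => hf (h ▸ hg)
      obtain ⟨x, hx⟩ := Function.ne_iff.mp hne
      have key : ∀ k ∈ S, ¬ ∀ y ∈ insert x T, f y = k y := by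
        intro k hk hfk
        have : g = k := hsep g hg k hk fun y hy => by
          rw [← hfg y hy, hfk y (Finset.mem_insert_of_mem hy)]
        exact hx (this ▸ hfk x (Finset.mem_insert_self x T))
      refine ⟨insert x T, ?_, ?_⟩
      · have := Finset.card_insert_le x T
        rw [Finset.card_cons]
        omega
      · simp only [Finset.mem_cons]
        rintro k (rfl | hk) l (rfl | hl) hkl
        · rfl
        · exact absurd hkl (key l hl)
        · exact absurd (fun y hy => (hkl y hy).symm) (key k hk)
        · exact hsep k hk l hl fun y hy => hkl y (Finset.mem_insert_of_mem hy)
    · push Not at h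
      refine ⟨T, by rw [Finset.card_cons]; omega, ?_⟩
      simp only [Finset.mem_cons]
      rintro k (rfl | hk) l (rfl | hl) hkl
      · rfl
      · obtain ⟨y, hy, hne⟩ := h l hl
        exact absurd (hkl y hy) hne
      · obtain ⟨y, hy, hne⟩ := h k hk
        exact absurd (hkl y hy).symm hne
      · exact hsep k hk l hl hkl

lemma ncard_realized_le_shatterCoeff (F : Set (X → Bool)) {m : ℕ} (x : Fin m → X) :
    Set.ncard {v : Fin m → Bool | ∃ f ∈ F, ∀ i, f (x i) = v i} ≤ shatterCoeff F m := by
  refine le_csSup ⟨2 ^ m, ?_⟩ ⟨x, rfl⟩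
  rintro k ⟨y, rfl⟩
  refine (Set.ncard_le_card _).trans ?_
  simp

lemma card_le_shatterCoeff [Nonempty X] {F : Set (X → Bool)} {S : Finset (X → Bool)}
    (hS : ↑S ⊆ F) {m : ℕ} (hm : S.card ≤ m + 1) : S.card ≤ shatterCoeff F m := by
  classical
  rcases S.eq_empty_or_nonempty with rfl | hne
  · simp
  obtain ⟨T, hT, hsep⟩ := exists_finset_card_lt_separating S hne
  obtain ⟨x, hx⟩ : ∃ x : Fin m → X, ∀ y ∈ T, ∃ i, x i = y := by
    let e := T.equivFin
    refine ⟨fun i => if h : (i : ℕ) < T.card then e.symm ⟨i, h⟩ else Classical.arbitrary X,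
      fun y hy => ⟨⟨e ⟨y, hy⟩, (e ⟨y, hy⟩).2.trans_le (by omega)⟩, ?_⟩⟩
    simp
  refine le_trans ?_ (ncard_realized_le_shatterCoeff F x)
  rw [← Set.ncard_coe_finset]
  refine Set.ncard_le_ncard_of_injOn (fun f i => f (x i)) (fun f hf => ⟨f, hS hf, fun i => rfl⟩) ?_
    (Set.toFinite _)
  intro f hf g hg hfg
  refine hsep f hf g hg fun y hy => ?_
  obtain ⟨i, rfl⟩ := hx y hy
  exact congrFun hfg i

/-- Either the class has at most `shatterCoeff F m` members, or `shatterCoeff F m` exceeds `m`. -/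
lemma encard_le_shatterCoeff_or_lt [Nonempty X] (F : Set (X → Bool)) (m : ℕ) :
    F.encard ≤ shatterCoeff F m ∨ m < shatterCoeff F m := by
  by_contra! h
  obtain ⟨h1, h2⟩ := h
  have h3 : ((shatterCoeff F m + 1 : ℕ) : ℕ∞) ≤ F.encard := by
    push_cast
    exact Order.add_one_le_of_lt h1
  obtain ⟨S, hSF, hS⟩ := Set.exists_subset_encard_eq h3
  have hfin : S.Finite := Set.finite_of_encard_eq_coe hS
  have hcard : hfin.toFinset.card = shatterCoeff F m + 1 := by
    rw [hfin.encard_eq_coe_toFinset_card] at hS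
    exact_mod_cast hS
  have := card_le_shatterCoeff (F := F) (S := hfin.toFinset) (by simpa using hSF)
    (m := m) (by omega)
  omega

end Shattering

section Loss

variable {X : Type*}

/-- The 0-1 loss of a classifier at a labeled point. -/
noncomputable def zeroOneLoss (f : X → Bool) (z : X × Bool) : ℝ := if f z.1 = z.2 then 0 else 1

lemma zeroOneLoss_mem_Icc (f : X → Bool) (z : X × Bool) : zeroOneLoss f z ∈ Set.Icc (0 : ℝ) 1 := by
  unfold zeroOneLoss
  split_ifs <;> simp

lemma empRisk_eq_sum {n : ℕ} (f : X → Bool) (s : Fin n → X × Bool) :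
    empRisk f s = (∑ i, zeroOneLoss f (s i)) / n := by
  simp only [empRisk, zeroOneLoss, Finset.card_filter, ne_eq, ite_not]
  push_cast
  rfl

variable [MeasurableSpace X]

lemma measurableSet_eq_label {f : X → Bool} (hf : Measurable f) :
    MeasurableSet {z : X × Bool | f z.1 = z.2} :=
  measurableSet_eq_fun (hf.comp measurable_fst) measurable_snd

lemma measurable_zeroOneLoss {f : X → Bool} (hf : Measurable f) : Measurable (zeroOneLoss f) :=
  Measurable.ite (measurableSet_eq_label hf) measurable_const measurable_const

lemma integral_zeroOneLoss (P : Measure (X × Bool)) {f : X → Bool} (hf : Measurable f) :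
    ∫ z, zeroOneLoss f z ∂P = risk P f := by
  have : zeroOneLoss f = Set.indicator {p : X × Bool | f p.1 ≠ p.2} 1 := by
    ext z
    by_cases h : f z.1 = z.2 <;> simp [zeroOneLoss, h]
  rw [this]
  exact integral_indicator_one (measurableSet_eq_label hf).compl

lemma measurable_empRisk {n : ℕ} {f : X → Bool} (hf : Measurable f) :
    Measurable fun s : Fin n → X × Bool => empRisk f s := by
  simp only [empRisk_eq_sum]
  exact (Finset.measurable_sum _ fun i _ =>
    (measurable_zeroOneLoss hf).comp (measurable_pi_apply i)).div_const _

lemma abs_risk_sub_empRisk_le_one {n : ℕ} (P : Measure (X × Bool)) [IsProbabilityMeasure P]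
    (f : X → Bool) (s : Fin n → X × Bool) : |risk P f - empRisk f s| ≤ 1 := by
  have h1 : 0 ≤ risk P f := ENNReal.toReal_nonneg
  have h2 : risk P f ≤ 1 := measureReal_le_one
  have h3 : 0 ≤ empRisk f s := by unfold empRisk; positivity
  have h4 : empRisk f s ≤ 1 := by
    refine div_le_one_of_le₀ ?_ (Nat.cast_nonneg n)
    exact_mod_cast (Finset.card_le_univ _).trans (by simp)
  rw [abs_le]
  constructor <;> linarith

lemma measureReal_abs_risk_sub_empRisk_gt_le {n : ℕ} (hn : 0 < n) (P : Measure (X × Bool))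
    [IsProbabilityMeasure P] {f : X → Bool} (hf : Measurable f) {t : ℝ} (ht : 0 ≤ t) :
    (Measure.pi fun _ : Fin n => P).real {s | t < |risk P f - empRisk f s|}
      ≤ 2 * Real.exp (-(2 * (n * t ^ 2))) := by
  have hn' : (0 : ℝ) < n := by exact_mod_cast hn
  have hint : Integrable (zeroOneLoss f) P :=
    Integrable.of_mem_Icc 0 1 (measurable_zeroOneLoss hf).aemeasurable
      (ae_of_all _ (zeroOneLoss_mem_Icc f))
  have h := measureReal_pi_abs_sum_gt_le (n := n) P
    (g := fun _ z => risk P f - zeroOneLoss f z) (a := risk P f - 1) (b := risk P f) (t := n * t)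
    (fun _ => measurable_const.sub (measurable_zeroOneLoss hf))
    (fun _ z => by
      have := zeroOneLoss_mem_Icc f z
      constructor <;> linarith [this.1, this.2])
    (fun _ => by
      rw [integral_sub (integrable_const _) hint, integral_zeroOneLoss P hf]
      simp)
    (by positivity)
  have hset : {s : Fin n → X × Bool | t < |risk P f - empRisk f s|}
      = {s | n * t < |∑ i, (risk P f - zeroOneLoss f (s i))|} := by
    ext s
    have : ∑ i, (risk P f - zeroOneLoss f (s i)) = n * (risk P f - empRisk f s) := by
      rw [empRisk_eq_sum, Finset.sum_sub_distrib, mul_sub, mul_div_cancel₀ _ hn'.ne']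
      simp
    simp only [Set.mem_ofPred_eq, this, abs_mul, abs_of_pos hn']
    exact (mul_lt_mul_iff_right₀ hn').symm
  rw [hset]
  refine h.trans_eq ?_
  congr 2
  field_simp
  ring

end Loss

section Symmetrization

variable {X : Type*}

/-- The uniform probability measure on signs. -/
noncomputable def signMeasure : Measure Bool := (PMF.uniformOfFintype Bool).toMeasure

instance : IsProbabilityMeasure signMeasure := by
  unfold signMeasure; infer_instance

/-- The real sign of a Boolean. -/
def boolSign (b : Bool) : ℝ := if b then 1 else -1

lemma integral_boolSign : ∫ b, boolSign b ∂signMeasure = 0 := by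
  rw [signMeasure, PMF.integral_eq_sum]
  simp [boolSign]

lemma measureReal_abs_sum_boolSign_gt_le {n : ℕ} {d : Fin n → ℝ} (hd : ∀ i, |d i| ≤ 1) {t : ℝ}
    (ht : 0 ≤ t) :
    (Measure.pi fun _ : Fin n => signMeasure).real {σ | t < |∑ i, boolSign (σ i) * d i|}
      ≤ 2 * Real.exp (-t ^ 2 / (2 * n)) := by
  have h := measureReal_pi_abs_sum_gt_le (n := n) signMeasure
    (g := fun i b => boolSign b * d i) (a := -1) (b := 1) (t := t)
    (fun _ => measurable_of_countable _)
    (fun i b => by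
      have := abs_le.mp (hd i)
      cases b <;> simp [boolSign] <;> constructor <;> linarith)
    (fun i => by rw [integral_mul_const, integral_boolSign, zero_mul]) ht
  refine h.trans_eq ?_
  norm_num

/-- The loss difference between the two components of a pair of labeled points. -/
noncomputable def lossDiff (f : X → Bool) (w : (X × Bool) × (X × Bool)) : ℝ :=
  zeroOneLoss f w.1 - zeroOneLoss f w.2

lemma abs_lossDiff_le_one (f : X → Bool) (w : (X × Bool) × (X × Bool)) : |lossDiff f w| ≤ 1 := by
  have h1 := zeroOneLoss_mem_Icc f w.1
  have h2 := zeroOneLoss_mem_Icc f w.2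
  rw [lossDiff, abs_le]
  constructor <;> linarith [h1.1, h1.2, h2.1, h2.2]

lemma measurable_lossDiff [MeasurableSpace X] {f : X → Bool} (hf : Measurable f) : Measurable (lossDiff f) :=
  ((measurable_zeroOneLoss hf).comp measurable_fst).sub
    ((measurable_zeroOneLoss hf).comp measurable_snd)

/-- Swap the components of a pair when the sign is negative. -/
def signSwap {Z : Type*} (b : Bool) (w : Z × Z) : Z × Z := if b then w else w.swap

lemma lossDiff_signSwap (f : X → Bool) (b : Bool) (w : (X × Bool) × (X × Bool)) :
    lossDiff f (signSwap b w) = boolSign b * lossDiff f w := by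
  cases b <;> simp [lossDiff, signSwap, boolSign]

lemma measurePreserving_signSwap {Z : Type*} [MeasurableSpace Z] (P : Measure Z)
    [IsProbabilityMeasure P] (b : Bool) :
    MeasurePreserving (signSwap b) (P.prod P) (P.prod P) := by
  cases b
  · exact Measure.measurePreserving_swap
  · exact MeasurePreserving.id _

/-- For fixed points, few sign vectors make some classifier have a large signed loss difference. -/
lemma measureReal_exists_abs_sum_boolSign_gt_le (F : Set (X → Bool)) {n : ℕ}
    (w : Fin n → (X × Bool) × (X × Bool)) {t : ℝ} (ht : 0 ≤ t) :
    (Measure.pi fun _ : Fin n => signMeasure).real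
        {σ | ∃ f ∈ F, t < |∑ i, boolSign (σ i) * lossDiff f (w i)|}
      ≤ shatterCoeff F (2 * n) * (2 * Real.exp (-t ^ 2 / (2 * n))) := by
  classical
  let e : Fin n ⊕ Fin n ≃ Fin (2 * n) := finSumFinEquiv.trans (finCongr (two_mul n).symm)
  let x : Fin (2 * n) → X := fun j => Sum.elim (fun i => (w i).1.1) (fun i => (w i).2.1) (e.symm j)
  set V := {v : Fin (2 * n) → Bool | ∃ f ∈ F, ∀ j, f (x j) = v j}
  let d (v : Fin (2 * n) → Bool) (i : Fin n) : ℝ :=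
    (if v (e (.inl i)) = (w i).1.2 then 0 else 1) - (if v (e (.inr i)) = (w i).2.2 then 0 else 1)
  have hd (v : Fin (2 * n) → Bool) (i : Fin n) : |d v i| ≤ 1 := by
    simp only [d]
    split_ifs <;> simp
  have hVfin : V.Finite := Set.toFinite V
  have hsub : {σ : Fin n → Bool | ∃ f ∈ F, t < |∑ i, boolSign (σ i) * lossDiff f (w i)|}
      ⊆ ⋃ v ∈ hVfin.toFinset, {σ | t < |∑ i, boolSign (σ i) * d v i|} := by
    rintro σ ⟨f, hf, hσ⟩
    simp only [Set.mem_iUnion, Set.Finite.mem_toFinset]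
    refine ⟨fun j => f (x j), ⟨f, hf, fun j => rfl⟩, ?_⟩
    simpa [d, x, lossDiff, zeroOneLoss] using hσ
  calc _ ≤ _ := measureReal_mono hsub (measure_ne_top _ _)
    _ ≤ ∑ v ∈ hVfin.toFinset, (Measure.pi fun _ : Fin n => signMeasure).real
          {σ | t < |∑ i, boolSign (σ i) * d v i|} := measureReal_biUnion_finset_le _ _
    _ ≤ ∑ _v ∈ hVfin.toFinset, 2 * Real.exp (-t ^ 2 / (2 * n)) :=
        Finset.sum_le_sum fun v _ => measureReal_abs_sum_boolSign_gt_le (hd v) ht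
    _ ≤ _ := by
        rw [Finset.sum_const, nsmul_eq_mul, ← Set.ncard_eq_toFinset_card V hVfin]
        gcongr
        exact ncard_realized_le_shatterCoeff F x

lemma measurableSet_exists_mem {ι α : Type*} [MeasurableSpace α] {F : Set ι} (hF : F.Countable)
    {p : ι → α → Prop} (hp : ∀ f ∈ F, MeasurableSet {a | p f a}) :
    MeasurableSet {a | ∃ f ∈ F, p f a} := by
  have : {a | ∃ f ∈ F, p f a} = ⋃ f ∈ F, {a | p f a} := by ext; simp
  rw [this]
  exact MeasurableSet.biUnion hF hp

variable [MeasurableSpace X]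

/-- Tail bound for the largest loss difference between a sample and a ghost sample. -/
lemma pi_prod_exists_abs_sum_lossDiff_gt_le (P : Measure (X × Bool)) [IsProbabilityMeasure P]
    {F : Set (X → Bool)} (hFc : F.Countable) (hFmeas : ∀ f ∈ F, Measurable f) {n : ℕ} {t : ℝ}
    (ht : 0 ≤ t) :
    (Measure.pi fun _ : Fin n => P.prod P) {w | ∃ f ∈ F, t < |∑ i, lossDiff f (w i)|}
      ≤ ENNReal.ofReal (shatterCoeff F (2 * n) * (2 * Real.exp (-t ^ 2 / (2 * n)))) := by
  set π := Measure.pi fun _ : Fin n => P.prod P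
  set S := Measure.pi fun _ : Fin n => signMeasure
  set B := {w : Fin n → (X × Bool) × (X × Bool) | ∃ f ∈ F, t < |∑ i, lossDiff f (w i)|}
  set E := {q : (Fin n → Bool) × (Fin n → (X × Bool) × (X × Bool)) |
    ∃ f ∈ F, t < |∑ i, boolSign (q.1 i) * lossDiff f (q.2 i)|}
  have hB : MeasurableSet B := measurableSet_exists_mem hFc fun f hf =>
    measurableSet_lt measurable_const <| measurable_norm.comp <| Finset.measurable_sum _ fun i _ =>
      (measurable_lossDiff (hFmeas f hf)).comp (measurable_pi_apply i)
  have hE : MeasurableSet E := measurableSet_exists_mem hFc fun f hf =>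
    measurableSet_lt measurable_const <| measurable_norm.comp <| Finset.measurable_sum _ fun i _ =>
      ((measurable_of_countable boolSign).comp
        ((measurable_pi_apply i).comp measurable_fst)).mul
      ((measurable_lossDiff (hFmeas f hf)).comp ((measurable_pi_apply i).comp measurable_snd))
  have hslice (σ : Fin n → Bool) : π (Prod.mk σ ⁻¹' E) = π B := by
    have hmp : MeasurePreserving (fun w i => signSwap (σ i) (w i)) π π :=
      measurePreserving_pi _ _ fun i => measurePreserving_signSwap P (σ i)
    rw [← hmp.measure_preimage hB.nullMeasurableSet]
    congr 1
    ext w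
    simp only [B, E, Set.mem_preimage, Set.mem_ofPred_eq, lossDiff_signSwap]
  calc π B = ∫⁻ σ, π (Prod.mk σ ⁻¹' E) ∂S := by simp [hslice]
    _ = ∫⁻ w, S ((fun σ => (σ, w)) ⁻¹' E) ∂π := by
        rw [← Measure.prod_apply hE, Measure.prod_apply_symm hE]
    _ ≤ ∫⁻ _, ENNReal.ofReal (shatterCoeff F (2 * n) * (2 * Real.exp (-t ^ 2 / (2 * n)))) ∂π := by
        refine lintegral_mono fun w => ?_
        rw [ENNReal.le_ofReal_iff_toReal_le (measure_ne_top _ _) (by positivity)]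
        exact measureReal_exists_abs_sum_boolSign_gt_le F w ht
    _ = _ := by simp

/-- Symmetrization by a ghost sample. -/
lemma measureReal_exists_abs_risk_sub_empRisk_gt_mul_le (P : Measure (X × Bool))
    [IsProbabilityMeasure P] {F : Set (X → Bool)} (hFc : F.Countable)
    (hFmeas : ∀ f ∈ F, Measurable f) {n : ℕ} (hn : 0 < n) {ε δ : ℝ} (hδ : 0 ≤ δ) (hδε : δ ≤ ε) :
    (Measure.pi fun _ : Fin n => P).real {s | ∃ f ∈ F, ε < |risk P f - empRisk f s|}
        * (1 - 2 * Real.exp (-(2 * (n * δ ^ 2))))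
      ≤ shatterCoeff F (2 * n) * (2 * Real.exp (-(n * (ε - δ) ^ 2) / 2)) := by
  have hn' : (0 : ℝ) < n := by exact_mod_cast hn
  set μ := Measure.pi fun _ : Fin n => P
  set A := {s : Fin n → X × Bool | ∃ f ∈ F, ε < |risk P f - empRisk f s|}
  set B := {w : Fin n → (X × Bool) × (X × Bool) |
    ∃ f ∈ F, n * (ε - δ) < |∑ i, lossDiff f (w i)|}
  set B' := {q : (Fin n → X × Bool) × (Fin n → X × Bool) |
    ∃ f ∈ F, n * (ε - δ) < |∑ i, lossDiff f (q.1 i, q.2 i)|}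
  have hA : MeasurableSet A := measurableSet_exists_mem hFc fun f hf =>
    measurableSet_lt measurable_const <| measurable_norm.comp <|
      measurable_const.sub (measurable_empRisk (hFmeas f hf))
  have hB' : MeasurableSet B' := measurableSet_exists_mem hFc fun f hf =>
    measurableSet_lt measurable_const <| measurable_norm.comp <| Finset.measurable_sum _ fun i _ =>
      (measurable_lossDiff (hFmeas f hf)).comp
        (((measurable_pi_apply i).comp measurable_fst).prodMk
          ((measurable_pi_apply i).comp measurable_snd))
  have hBB' : (μ.prod μ) B' = (Measure.pi fun _ : Fin n => P.prod P) B :=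
    ((measurePreserving_arrowProdEquivProdArrow _ _ (Fin n) (fun _ => P)
      fun _ => P).measure_preimage hB'.nullMeasurableSet).symm
  have hslice : ∀ s ∈ A, ENNReal.ofReal (1 - 2 * Real.exp (-(2 * (n * δ ^ 2))))
      ≤ μ (Prod.mk s ⁻¹' B') := by
    rintro s ⟨f, hf, hs⟩
    have hC : MeasurableSet {s' : Fin n → X × Bool | δ < |risk P f - empRisk f s'|} :=
      measurableSet_lt measurable_const <| measurable_norm.comp <|
        measurable_const.sub (measurable_empRisk (hFmeas f hf))
    have hsub : {s' : Fin n → X × Bool | δ < |risk P f - empRisk f s'|}ᶜ ⊆ Prod.mk s ⁻¹' B' := by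
      intro s' hs'
      simp only [Set.mem_compl_iff, Set.mem_ofPred_eq, not_lt] at hs'
      refine ⟨f, hf, ?_⟩
      have heq : ∑ i, lossDiff f (s i, s' i) = n * (empRisk f s - empRisk f s') := by
        simp only [lossDiff, Finset.sum_sub_distrib, empRisk_eq_sum]
        field_simp
      rw [heq, abs_mul, abs_of_pos hn']
      refine mul_lt_mul_of_pos_left ?_ hn'
      have := abs_sub_abs_le_abs_sub (risk P f - empRisk f s) (risk P f - empRisk f s')
      rw [show risk P f - empRisk f s - (risk P f - empRisk f s')
        = -(empRisk f s - empRisk f s') by ring, abs_neg] at this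
      linarith
    refine le_trans ?_ (measure_mono hsub)
    refine ENNReal.ofReal_le_of_le_toReal ?_
    change _ ≤ μ.real _
    rw [probReal_compl_eq_one_sub hC]
    linarith [measureReal_abs_risk_sub_empRisk_gt_le hn P (hFmeas f hf) hδ]
  have hmain : μ A * ENNReal.ofReal (1 - 2 * Real.exp (-(2 * (n * δ ^ 2))))
      ≤ ENNReal.ofReal (shatterCoeff F (2 * n) * (2 * Real.exp (-(n * (ε - δ) ^ 2) / 2))) := by
    calc _ = ∫⁻ _ in A, ENNReal.ofReal (1 - 2 * Real.exp (-(2 * (n * δ ^ 2)))) ∂μ := by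
          rw [setLIntegral_const, mul_comm]
      _ ≤ ∫⁻ s in A, μ (Prod.mk s ⁻¹' B') ∂μ := setLIntegral_mono' hA hslice
      _ ≤ ∫⁻ s, μ (Prod.mk s ⁻¹' B') ∂μ := setLIntegral_le_lintegral _ _
      _ = (Measure.pi fun _ : Fin n => P.prod P) B := by rw [← Measure.prod_apply hB', hBB']
      _ ≤ _ := pi_prod_exists_abs_sum_lossDiff_gt_le P hFc hFmeas
          (mul_nonneg hn'.le (sub_nonneg.mpr hδε))
      _ = _ := by
          congr 4
          field_simp
  have hreal := ENNReal.toReal_mono ENNReal.ofReal_ne_top hmain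
  rw [ENNReal.toReal_mul, ENNReal.toReal_ofReal',
    ENNReal.toReal_ofReal (by positivity)] at hreal
  exact (mul_le_mul_of_nonneg_left (le_max_left _ _) measureReal_nonneg).trans hreal

end Symmetrization

/-- If the deviation bound is nontrivial and `N` exceeds `2 * n`, the exponent is large. -/
lemma sixteen_le_of_two_mul_exp_lt_one {n N : ℕ} {u : ℝ} (hu : 2 ≤ u) (hun : u ≤ n)
    (hN : 2 * n < N) (h : 2 * N * Real.exp (-u / 4) < 1) : 16 ≤ u := by
  have hlt : 2 * (N : ℝ) < Real.exp (u / 4) := by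
    rw [neg_div, Real.exp_neg, ← div_eq_mul_inv, div_lt_one (Real.exp_pos _)] at h
    exact h
  have hstep (k a : ℕ) (hk : (k : ℝ) ≤ u) (ha : Real.exp 1 ^ a ≤ (2 * (2 * k + 1)) ^ 2) :
      2 * (a : ℝ) < u := by
    have hkn : k ≤ n := by exact_mod_cast hk.trans hun
    have hkN : 2 * (2 * (k : ℝ) + 1) ≤ 2 * N := by
      have : 2 * k + 1 ≤ N := by omega
      exact_mod_cast Nat.mul_le_mul_left 2 this
    have h1 : Real.exp a < Real.exp (u / 4) ^ 2 := by
      rw [← Real.exp_one_pow]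
      exact ha.trans_lt (pow_lt_pow_left₀ (hkN.trans_lt hlt) (by positivity) two_ne_zero)
    rw [← Real.exp_nat_mul, Real.exp_lt_exp] at h1
    push_cast at h1
    linarith
  have he := Real.exp_one_lt_d9
  have hpow (a : ℕ) : Real.exp 1 ^ a ≤ 2.72 ^ a := by gcongr; linarith
  have h8 := hstep 2 4 (by exact_mod_cast hu) ((hpow 4).trans (by norm_num))
  have h14 := hstep 8 7 (by push_cast at h8 ⊢; linarith) ((hpow 7).trans (by norm_num))
  have h16 := hstep 14 8 (by push_cast at h14 ⊢; linarith) ((hpow 8).trans (by norm_num))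
  push_cast at h16
  linarith

/-- **Uniform deviation bound via the shattering coefficient.** For a countable class `F` of
classifiers and every `ε > 0` with `n ε² ≥ 2`,
`Pr(sup_{f ∈ F} |R(f) − R_emp(f)| > ε) ≤ 2 N(F, 2n) exp(−n ε² / 4)`. -/
theorem shattering_uniform_deviation_bound {X : Type*} [MeasurableSpace X]
    (P : Measure (X × Bool)) [IsProbabilityMeasure P]
    (F : Set (X → Bool)) (hFc : F.Countable) (hFmeas : ∀ f ∈ F, Measurable f)
    (n : ℕ) (ε : ℝ) (hε : 0 < ε) (hnε : 2 ≤ n * ε ^ 2) :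
    ((Measure.pi fun _ : Fin n => P)
        {s | ε < ⨆ f : F, |risk P f - empRisk (f : X → Bool) s|}).toReal
      ≤ 2 * shatterCoeff F (2 * n) * Real.exp (-(n * ε ^ 2) / 4) := by
  have hn : 0 < n := by
    rcases Nat.eq_zero_or_pos n with rfl | h
    · norm_num at hnε
    · exact h
  have hX : Nonempty X := (nonempty_of_isProbabilityMeasure P).map Prod.fst
  set N := shatterCoeff F (2 * n)
  have hset : {s : Fin n → X × Bool | ε < ⨆ f : F, |risk P f - empRisk (f : X → Bool) s|}
      ⊆ {s | ∃ f ∈ F, ε < |risk P f - empRisk f s|} := by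
    intro s (hs : ε < _)
    rcases isEmpty_or_nonempty F with hF | hF
    · rw [Real.iSup_of_isEmpty] at hs
      exact absurd hs hε.not_gt
    · obtain ⟨f, hf⟩ := exists_lt_of_lt_ciSup hs
      exact ⟨f, f.2, hf⟩
  refine (measureReal_mono hset).trans ?_
  set μ := Measure.pi fun _ : Fin n => P
  rcases encard_le_shatterCoeff_or_lt F (2 * n) with hF | hN
  · have hfin : F.Finite := Set.finite_of_encard_le_coe hF
    have hcard : hfin.toFinset.card ≤ N := by
      rw [hfin.encard_eq_coe_toFinset_card] at hF
      exact_mod_cast hF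
    calc μ.real {s | ∃ f ∈ F, ε < |risk P f - empRisk f s|}
        ≤ μ.real (⋃ f ∈ hfin.toFinset, {s | ε < |risk P f - empRisk f s|}) :=
          measureReal_mono (fun s hs => by simpa using hs) (measure_ne_top _ _)
      _ ≤ ∑ f ∈ hfin.toFinset, μ.real {s | ε < |risk P f - empRisk f s|} :=
          measureReal_biUnion_finset_le _ _
      _ ≤ ∑ _f ∈ hfin.toFinset, 2 * Real.exp (-(n * ε ^ 2) / 4) := by
          refine Finset.sum_le_sum fun f hf => ?_
          refine (measureReal_abs_risk_sub_empRisk_gt_le hn P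
            (hFmeas f (by simpa using hf)) hε.le).trans ?_
          gcongr
          linarith
      _ ≤ 2 * N * Real.exp (-(n * ε ^ 2) / 4) := by
          rw [Finset.sum_const, nsmul_eq_mul, ← mul_assoc, mul_comm (_ : ℝ) 2]
          gcongr
  · rcases le_or_gt 1 (2 * (N : ℝ) * Real.exp (-(n * ε ^ 2) / 4)) with htriv | hsmall
    · exact measureReal_le_one.trans htriv
    rcases lt_or_ge 1 ε with hε1 | hε1
    · have hempty : {s : Fin n → X × Bool | ∃ f ∈ F, ε < |risk P f - empRisk f s|} = ∅ := by
        ext s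
        simp only [Set.mem_ofPred_eq, Set.mem_empty_iff_false, iff_false, not_exists, not_and, not_lt]
        exact fun f _ => (abs_risk_sub_empRisk_le_one P f s).trans hε1.le
      rw [hempty, measureReal_empty]
      positivity
    have hu := sixteen_le_of_two_mul_exp_lt_one hnε
      (mul_le_of_le_one_right n.cast_nonneg (pow_le_one₀ hε.le hε1)) hN hsmall
    have hsymm := measureReal_exists_abs_risk_sub_empRisk_gt_mul_le P hFc hFmeas hn
      (ε := ε) (δ := ε / 4) (by positivity) (by linarith)
    set u := n * ε ^ 2
    rw [show -(2 * (n * (ε / 4) ^ 2)) = -(u / 8) by simp only [u]; ring,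
      show -(n * (ε - ε / 4) ^ 2) / 2 = -u / 4 + -(u / 32) by simp only [u]; ring,
      Real.exp_add] at hsymm
    have hghost : Real.exp (-(u / 8)) ≤ 1 / 6 := by
      rw [Real.exp_neg, inv_eq_one_div]
      gcongr
      calc (6 : ℝ) ≤ Real.exp 1 ^ 2 := by nlinarith [Real.exp_one_gt_d9]
        _ = Real.exp 2 := by rw [Real.exp_one_pow]; norm_num
        _ ≤ Real.exp (u / 8) := by gcongr; linarith
    have hgain : Real.exp (-(u / 32)) ≤ 2 / 3 := by
      rw [Real.exp_neg, inv_le_comm₀ (Real.exp_pos _) (by norm_num)]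
      linarith [Real.add_one_le_exp (u / 32)]
    have hlow : μ.real {s | ∃ f ∈ F, ε < |risk P f - empRisk f s|} * (2 / 3)
        ≤ 2 * N * Real.exp (-u / 4) * (2 / 3) :=
      calc _ ≤ _ := mul_le_mul_of_nonneg_left (by linarith) measureReal_nonneg
        _ ≤ _ := hsymm
        _ = 2 * N * Real.exp (-u / 4) * Real.exp (-(u / 32)) := by ring
        _ ≤ _ := by gcongr
    exact le_of_mul_le_mul_right hlow (by norm_num)
end

section
/- (Vapnik–Chervonenkis–Sauer–Shelah lemma.) Let F be a class of classifiers with finite VC dimension d. Then for every n ∈ ℕ, N(F, n) ≤ ∑_{i=0}^{d} C(n, i), where C(n, i) is the binomial coefficient. In particular, for all n ≥ d, N(F, n) ≤ (e·n/d)^d. -/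
/-- `F` shatters some set of `m` points: all `2^m` labelings of these points are realized by
functions in `F`. -/
def ShattersCard {X : Type*} (F : Set (X → Bool)) (m : ℕ) : Prop :=
  ∃ x : Fin m → X, ∀ v : Fin m → Bool, ∃ f ∈ F, ∀ i, f (x i) = v i

/-- The traces of `F` on the points `x`, each recorded as the set of indices labelled `true`. -/
noncomputable def traceFamily {X : Type*} (F : Set (X → Bool)) {n : ℕ} (x : Fin n → X) :
    Finset (Finset (Fin n)) :=
  (Set.toFinite {v : Fin n → Bool | ∃ f ∈ F, ∀ i, f (x i) = v i}).toFinset.image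
    fun v => Finset.univ.filter fun i => v i = true

lemma mem_traceFamily {X : Type*} {F : Set (X → Bool)} {n : ℕ} {x : Fin n → X}
    {u : Finset (Fin n)} :
    u ∈ traceFamily F x ↔ ∃ f ∈ F, ∀ i, f (x i) = true ↔ i ∈ u := by
  simp only [traceFamily, Finset.mem_image, Set.Finite.mem_toFinset, Set.mem_ofPred_eq]
  constructor
  · rintro ⟨v, ⟨f, hf, hv⟩, rfl⟩
    exact ⟨f, hf, fun i => by simp [hv]⟩
  · rintro ⟨f, hf, hu⟩
    exact ⟨fun i => f (x i), ⟨f, hf, fun _ => rfl⟩, by ext i; simp [hu]⟩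

lemma card_traceFamily {X : Type*} (F : Set (X → Bool)) {n : ℕ} (x : Fin n → X) :
    (traceFamily F x).card =
      Set.ncard {v : Fin n → Bool | ∃ f ∈ F, ∀ i, f (x i) = v i} := by
  rw [traceFamily, Finset.card_image_of_injective, Set.ncard_eq_toFinset_card]
  intro v w h
  funext i
  simpa [← Bool.eq_iff_iff] using Finset.ext_iff.mp h i

lemma Finset.Shatters.shattersCard {X : Type*} {F : Set (X → Bool)} {n : ℕ} {x : Fin n → X}
    {s : Finset (Fin n)} (hs : (traceFamily F x).Shatters s) : ShattersCard F s.card := by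
  refine ⟨fun i => x (s.orderEmbOfFin rfl i), fun v => ?_⟩
  obtain ⟨u, hu, hsu⟩ := hs (t := (Finset.univ.filter fun i => v i = true).map
    (s.orderEmbOfFin rfl).toEmbedding) (by
      intro j hj
      obtain ⟨i, -, rfl⟩ := Finset.mem_map.mp hj
      exact s.orderEmbOfFin_mem rfl i)
  obtain ⟨f, hf, hfu⟩ := mem_traceFamily.mp hu
  refine ⟨f, hf, fun i => Bool.eq_iff_iff.mpr ?_⟩
  have h := Finset.ext_iff.mp hsu (s.orderEmbOfFin rfl i)
  simpa [hfu] using h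

lemma shatterCoeff_le_sum_choose {X : Type*} {F : Set (X → Bool)} {d : ℕ}
    (hd : d ∈ upperBounds {m : ℕ | ShattersCard F m}) (n : ℕ) :
    shatterCoeff F n ≤ ∑ i ∈ Finset.range (d + 1), n.choose i := by
  refine csSup_le' ?_
  rintro _ ⟨x, rfl⟩
  have hdim : (traceFamily F x).vcDim ≤ d :=
    Finset.sup_le fun s hs => hd (Finset.mem_shatterer.mp hs).shattersCard
  calc _ = (traceFamily F x).card := (card_traceFamily F x).symm
    _ ≤ (traceFamily F x).shatterer.card := Finset.card_le_card_shatterer _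
    _ ≤ ∑ i ∈ Finset.Iic (traceFamily F x).vcDim, n.choose i := by
      simpa using Finset.card_shatterer_le_sum_vcDim (𝒜 := traceFamily F x)
    _ ≤ _ := Finset.sum_le_sum_of_subset fun i hi => by
      simp only [Finset.mem_Iic, Finset.mem_range] at *
      omega

lemma sum_choose_le_exp_mul_div_pow {n d : ℕ} (hdn : d ≤ n) :
    ((∑ i ∈ Finset.range (d + 1), n.choose i : ℕ) : ℝ) ≤ (Real.exp 1 * n / d) ^ d := by
  rcases Nat.eq_zero_or_pos d with rfl | hd
  · simp
  have hd' : (0 : ℝ) < d := by exact_mod_cast hd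
  have hn' : (0 : ℝ) < n := by exact_mod_cast hd.trans_le hdn
  have hq : (0 : ℝ) < d / n := by positivity
  have hq1 : (d / n : ℝ) ≤ 1 := (div_le_one hn').mpr (by exact_mod_cast hdn)
  have key : ((∑ i ∈ Finset.range (d + 1), n.choose i : ℕ) : ℝ) * (d / n : ℝ) ^ d
      ≤ Real.exp 1 ^ d :=
    calc ((∑ i ∈ Finset.range (d + 1), n.choose i : ℕ) : ℝ) * (d / n : ℝ) ^ d
        = ∑ i ∈ Finset.range (d + 1), (d / n : ℝ) ^ d * n.choose i := by
          rw [Nat.cast_sum, mul_comm, Finset.mul_sum]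
      _ ≤ ∑ i ∈ Finset.range (d + 1), (d / n : ℝ) ^ i * n.choose i := by
          refine Finset.sum_le_sum fun i hi => ?_
          gcongr ?_ * _
          exact pow_le_pow_of_le_one hq.le hq1 (Finset.mem_range_succ_iff.mp hi)
      _ ≤ ∑ i ∈ Finset.range (n + 1), (d / n : ℝ) ^ i * n.choose i :=
          Finset.sum_le_sum_of_subset_of_nonneg
            (Finset.range_subset_range.mpr (by omega)) fun _ _ _ => by positivity
      _ = (d / n + 1 : ℝ) ^ n := by simp [add_pow]
      _ ≤ Real.exp (d / n) ^ n := by gcongr; exact Real.add_one_le_exp _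
      _ = Real.exp 1 ^ d := by
          rw [← Real.exp_nat_mul, ← Real.exp_nat_mul]
          congr 1
          field_simp
  rw [← le_div_iff₀ (by positivity), ← div_pow] at key
  rwa [show Real.exp 1 * n / d = Real.exp 1 / (d / n : ℝ) by field_simp]

/-- **Vapnik–Chervonenkis–Sauer–Shelah lemma.** If `F` has finite VC dimension `d` (i.e. `d` is
the largest size of a shattered set), then `N(F, n) ≤ ∑_{i=0}^{d} C(n, i)` for every `n`, and
`N(F, n) ≤ (e n / d)^d` for all `n ≥ d`. -/
theorem sauer_shelah {X : Type*} (F : Set (X → Bool)) (d : ℕ)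
    (hd : IsGreatest {m : ℕ | ShattersCard F m} d) :
    (∀ n : ℕ, shatterCoeff F n ≤ ∑ i ∈ Finset.range (d + 1), n.choose i) ∧
      ∀ n : ℕ, d ≤ n →
        (shatterCoeff F n : ℝ) ≤ (Real.exp 1 * n / d) ^ d := by
  refine ⟨shatterCoeff_le_sum_choose hd.2, fun n hn => ?_⟩
  exact (Nat.cast_le.mpr (shatterCoeff_le_sum_choose hd.2 n)).trans
    (sum_choose_le_exp_mul_div_pow hn)
end

section
/- (Stone's theorem.) Let 𝒳 = ℝ^d with the Euclidean distance and 𝒴 = {−1, +1}, and let P be any probability distribution on 𝒳 × 𝒴. Let (k_n) be a sequence of positive integers with k_n → ∞ and k_n/n → 0 as n → ∞. For each n, let f_n be the k_n-nearest neighbor classifier built from an i.i.d. n-sample (X_1, Y_1), …, (X_n, Y_n) from P: for a point x, f_n(x) = +1 if the sum of the labels Y_i over the k_n sample points X_i nearest to x (distance ties broken using independent auxiliary uniform [0,1] random variables U_1, …, U_n attached to the sample points, preferring the point with smaller U_i) is positive, and f_n(x) = −1 otherwise. Then E[R(f_n)] → R* as n → ∞, where R* is the Bayes risk of P. In particular,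 the k-nearest neighbor rule is universally Bayes-consistent. -/
open MeasureTheory Filter

/-- The Bayes risk: the infimum of the risk over all measurable classifiers. -/
noncomputable def bayesRisk {X : Type*} [MeasurableSpace X] (P : Measure (X × Bool)) : ℝ :=
  ⨅ f : {f : X → Bool // Measurable f}, risk P (f : X → Bool)

/-- The `k`-nearest neighbor classifier built from a sample of `n` labeled points in `ℝ^d`,
each equipped with an auxiliary real number used to break distance ties (the point with the
smaller auxiliary value is preferred). A point `i` is among the `k` nearest neighbors of `x`
iff fewer than `k` sample points strictly precede it in the order "smaller distance to `x`,
ties broken by smaller auxiliary value". The predicted label is `+1` (i.e. `true`) iff the sum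
of the `±1` labels of the `k` nearest neighbors is positive. -/
noncomputable def knnClassifier {d n : ℕ} (k : ℕ)
    (s : Fin n → (EuclideanSpace ℝ (Fin d) × Bool) × ℝ)
    (x : EuclideanSpace ℝ (Fin d)) : Bool :=
  decide (0 < ∑ i ∈ Finset.univ.filter (fun i : Fin n =>
      (Finset.univ.filter (fun j : Fin n =>
        dist x (s j).1.1 < dist x (s i).1.1 ∨
          (dist x (s j).1.1 = dist x (s i).1.1 ∧ (s j).2 < (s i).2))).card < k),
    if (s i).1.2 then (1 : ℤ) else -1)


section Resampling

variable {ι Z : Type*} [Fintype ι] [DecidableEq ι] [MeasurableSpace Z]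

/-- Exchanging a fresh point with one coordinate of an i.i.d. sample preserves the law. -/
theorem measurePreserving_exchange (Q : Measure Z) [IsProbabilityMeasure Q] (i : ι) :
    MeasurePreserving (fun q : Z × (ι → Z) => (q.2 i, Function.update q.2 i q.1))
      (Q.prod (Measure.pi fun _ : ι => Q)) (Q.prod (Measure.pi fun _ : ι => Q)) := by
  have hm : Measurable (fun q : Z × (ι → Z) => (q.2 i, Function.update q.2 i q.1)) := by
    refine Measurable.prodMk (by fun_prop) (measurable_pi_lambda _ fun j => ?_)
    by_cases h : j = i
    · subst h; simpa using measurable_fst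
    · simp only [Function.update_of_ne h]; fun_prop
  refine ⟨hm, ?_⟩
  symm
  refine Measure.prod_eq_generateFrom (C := {s | MeasurableSet s})
    (D := Set.pi Set.univ '' Set.pi Set.univ fun _ : ι => {s : Set Z | MeasurableSet s})
    MeasurableSpace.generateFrom_measurableSet generateFrom_pi
    MeasurableSpace.isPiSystem_measurableSet isPiSystem_pi
    Q.toFiniteSpanningSetsIn
    ⟨fun _ => Set.univ, fun _ => ⟨fun _ => Set.univ, by simp, by simp⟩, by simp,
      Set.iUnion_const _⟩ ?_
  rintro A hA _ ⟨B, hB, rfl⟩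
  have hB' : ∀ j, MeasurableSet (B j) := fun j => hB j (Set.mem_univ j)
  rw [Measure.map_apply hm (hA.prod (MeasurableSet.univ_pi hB'))]
  have : (fun q : Z × (ι → Z) => (q.2 i, Function.update q.2 i q.1)) ⁻¹'
      (A ×ˢ Set.pi Set.univ B) = B i ×ˢ Set.pi Set.univ (Function.update B i A) := by
    ext ⟨z, s⟩
    simp only [Set.mem_preimage, Set.mem_prod, Set.mem_univ_pi]
    constructor
    · rintro ⟨h1, h2⟩
      refine ⟨by simpa using h2 i, fun j => ?_⟩
      by_cases h : j = i
      · subst h; simpa using h1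
      · simpa [h] using h2 j
    · rintro ⟨h1, h2⟩
      refine ⟨by simpa using h2 i, fun j => ?_⟩
      by_cases h : j = i
      · subst h; simpa using h1
      · simpa [h] using h2 j
  rw [this, Measure.prod_prod, Measure.pi_pi, Measure.pi_pi,
    ← Finset.mul_prod_erase _ _ (Finset.mem_univ i),
    ← Finset.mul_prod_erase _ (fun j => Q (B j)) (Finset.mem_univ i)]
  have : ∏ j ∈ Finset.univ.erase i, Q (Function.update B i A j)
      = ∏ j ∈ Finset.univ.erase i, Q (B j) :=
    Finset.prod_congr rfl fun j hj => by rw [Function.update_of_ne (Finset.ne_of_mem_erase hj)]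
  rw [this, Function.update_self]
  ring

theorem measurePreserving_update (Q : Measure Z) [IsProbabilityMeasure Q] (i : ι) :
    MeasurePreserving (fun q : Z × (ι → Z) => Function.update q.2 i q.1)
      (Q.prod (Measure.pi fun _ : ι => Q)) (Measure.pi fun _ : ι => Q) :=
  measurePreserving_snd.comp (measurePreserving_exchange Q i)

theorem integral_pi_eq_zero_of_update {Q : Measure Z} [IsProbabilityMeasure Q] (i : ι)
    {F : (ι → Z) → ℝ} (hF : Integrable F (Measure.pi fun _ : ι => Q))
    (h : ∀ s, ∫ z, F (Function.update s i z) ∂Q = 0) :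
    ∫ s, F s ∂(Measure.pi fun _ : ι => Q) = 0 := by
  have hT := measurePreserving_update Q i
  rw [← hT.map_eq, integral_map hT.aemeasurable (by rw [hT.map_eq]; exact hF.1),
    integral_prod_symm (fun q : Z × (ι → Z) => F (Function.update q.2 i q.1))
      (hT.integrable_comp_of_integrable hF)]
  simp [h]

theorem pi_coord_eq_null {Q : Measure Z} [IsProbabilityMeasure Q] {f : Z → ℝ}
    (hf : Measurable f) (hQ : ∀ c, Q (f ⁻¹' {c}) = 0) {i j : ι} (hij : i ≠ j) :
    (Measure.pi fun _ : ι => Q) {s | f (s i) = f (s j)} = 0 := by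
  have hm : MeasurableSet {s : ι → Z | f (s i) = f (s j)} :=
    measurableSet_eq_fun (by fun_prop) (by fun_prop)
  rw [← (measurePreserving_update Q i).measure_preimage hm.nullMeasurableSet,
    Measure.prod_apply_symm ((measurePreserving_update Q i).measurable hm)]
  refine (lintegral_congr fun s => ?_).trans lintegral_zero
  rw [← hQ (f (s j))]
  congr 1
  ext z
  simp [Function.update_of_ne hij.symm]

theorem ae_pi_injective {Q : Measure Z} [IsProbabilityMeasure Q] {f : Z → ℝ}
    (hf : Measurable f) (hQ : ∀ c, Q (f ⁻¹' {c}) = 0) :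
    ∀ᵐ s ∂(Measure.pi fun _ : ι => Q), Function.Injective fun i => f (s i) := by
  have : ∀ᵐ s ∂(Measure.pi fun _ : ι => Q), ∀ i j : ι, i ≠ j → f (s i) ≠ f (s j) := by
    refine ae_all_iff.2 fun i => ae_all_iff.2 fun j => ?_
    by_cases hij : i = j
    · simp [hij]
    · have := pi_coord_eq_null hf hQ hij
      filter_upwards [measure_eq_zero_iff_ae_notMem.1 this] with s hs _ using hs
  filter_upwards [this] with s hs i j h
  by_contra hne
  exact hs i j hne h

end Resampling

theorem integral_sq_sum_of_orthogonal {ι Ω : Type*} [Fintype ι] [MeasurableSpace Ω] {ν : Measure Ω}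
    [IsProbabilityMeasure ν] {F : ι → Ω → ℝ} {C : ℝ} (hF : ∀ i, Measurable (F i))
    (hC : ∀ i ω, |F i ω| ≤ C) (h : ∀ i j, i ≠ j → ∫ ω, F i ω * F j ω ∂ν = 0) :
    ∫ ω, (∑ i, F i ω) ^ 2 ∂ν = ∑ i, ∫ ω, F i ω ^ 2 ∂ν := by
  have hint : ∀ i j, Integrable (fun ω => F i ω * F j ω) ν := fun i j =>
    Integrable.of_bound ((hF i).mul (hF j)).aestronglyMeasurable (C * C) <| .of_forall fun ω => by
      rw [Real.norm_eq_abs, abs_mul]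
      exact mul_le_mul (hC i ω) (hC j ω) (abs_nonneg _) ((abs_nonneg _).trans (hC i ω))
  simp_rw [sq, Finset.sum_mul_sum]
  rw [integral_finsetSum _ fun i _ => integrable_finsetSum _ fun j _ => hint i j]
  refine Finset.sum_congr rfl fun i _ => ?_
  rw [integral_finsetSum _ fun j _ => hint i j]
  exact Finset.sum_eq_single i (fun j _ hj => h i j hj.symm) (by simp)

section NearestNeighbors

variable {E : Type*} {n : ℕ}

section Metric

variable [MetricSpace E]

/-- The indices of the sample points which strictly precede the `i`-th one in the order
"smaller distance to `x`, ties broken by smaller auxiliary value". -/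
noncomputable def closerPoints (s : Fin n → (E × Bool) × ℝ) (x : E) (i : Fin n) :
    Finset (Fin n) :=
  Finset.univ.filter fun j : Fin n =>
    dist x (s j).1.1 < dist x (s i).1.1 ∨
      (dist x (s j).1.1 = dist x (s i).1.1 ∧ (s j).2 < (s i).2)

/-- The indices of the `k` nearest neighbors of `x` in the sample `s`. -/
noncomputable def nearestNeighbors (k : ℕ) (s : Fin n → (E × Bool) × ℝ) (x : E) :
    Finset (Fin n) :=
  Finset.univ.filter fun i : Fin n => (closerPoints s x i).card < k

theorem card_nearestNeighbors {s : Fin n → (E × Bool) × ℝ}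
    (hs : Function.Injective fun i => (s i).2) {k : ℕ} (hk : k ≤ n) (x : E) :
    (nearestNeighbors k s x).card = k := by
  have hlt : ∀ i, (closerPoints s x i).card < n := fun i => by
    have : closerPoints s x i ⊂ Finset.univ := by
      refine Finset.ssubset_univ_iff.2 fun h => ?_
      have := h ▸ Finset.mem_univ i
      simp [closerPoints] at this
    simpa using Finset.card_lt_card this
  have hmono : ∀ i j, i ∈ closerPoints s x j →
      (closerPoints s x i).card < (closerPoints s x j).card := fun i j hij => by
    refine Finset.card_lt_card ⟨fun l hl => ?_, fun h => ?_⟩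
    · simp only [closerPoints, Finset.mem_filter, Finset.mem_univ, true_and] at hij hl ⊢
      grind
    · have := h hij
      simp [closerPoints] at this
  let r : Fin n → Fin n := fun i => ⟨(closerPoints s x i).card, hlt i⟩
  have hr : Function.Injective r := fun i j hij => by
    by_contra hne
    have hc : (closerPoints s x i).card = (closerPoints s x j).card := congrArg Fin.val hij
    have hu : (s i).2 ≠ (s j).2 := fun h => hne (hs h)
    have : i ∈ closerPoints s x j ∨ j ∈ closerPoints s x i := by
      simp only [closerPoints, Finset.mem_filter, Finset.mem_univ, true_and]
      grind
    rcases this with h | h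
    · exact (hmono _ _ h).ne hc
    · exact (hmono _ _ h).ne hc.symm
  have hb : Function.Bijective r := Finite.injective_iff_bijective.1 hr
  have : (nearestNeighbors k s x).card = (Finset.univ.filter fun i : Fin n => (i : ℕ) < k).card :=
    Finset.card_bij (fun i _ => r i) (fun i hi => by simpa [nearestNeighbors, r] using hi)
      (fun i _ j _ h => hr h) fun j hj => by
        obtain ⟨i, rfl⟩ := hb.2 j
        exact ⟨i, by simpa [nearestNeighbors, r] using hj, rfl⟩
  rw [this, Fin.card_filter_val_lt, min_eq_right hk]

theorem card_ball_lt_of_mem_nearestNeighbors {s : Fin n → (E × Bool) × ℝ} {k : ℕ} {x : E} {δ : ℝ}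
    {i : Fin n} (hi : i ∈ nearestNeighbors k s x) (hδ : δ ≤ dist x (s i).1.1) :
    (Finset.univ.filter fun j : Fin n => dist x (s j).1.1 < δ).card < k := by
  refine lt_of_le_of_lt (Finset.card_le_card fun j hj => ?_) (Finset.mem_filter.1 hi).2
  simp only [closerPoints, Finset.mem_filter, Finset.mem_univ, true_and] at hj ⊢
  exact Or.inl (hj.trans_le hδ)

/-- Membership in the set of nearest neighbors does not depend on the labels. -/
theorem nearestNeighbors_congr {s t : Fin n → (E × Bool) × ℝ} (hX : ∀ i, (s i).1.1 = (t i).1.1)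
    (hU : ∀ i, (s i).2 = (t i).2) (k : ℕ) (x : E) :
    nearestNeighbors k s x = nearestNeighbors k t x := by
  simp only [nearestNeighbors, closerPoints, hX, hU]
  congr!

theorem measurableSet_mem_nearestNeighbors [MeasurableSpace E] [BorelSpace E]
    [SecondCountableTopology E] {Ω : Type*} [MeasurableSpace Ω]
    {a : Ω → Fin n → (E × Bool) × ℝ} {b : Ω → E} (ha : Measurable a) (hb : Measurable b)
    (k : ℕ) (i : Fin n) : MeasurableSet {ω | i ∈ nearestNeighbors k (a ω) (b ω)} := by
  have hX : ∀ j, Measurable fun ω => dist (b ω) (a ω j).1.1 := fun j =>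
    hb.dist (measurable_fst.comp (measurable_fst.comp ((measurable_pi_apply j).comp ha)))
  have hU : ∀ j, Measurable fun ω => (a ω j).2 := fun j =>
    measurable_snd.comp ((measurable_pi_apply j).comp ha)
  simp only [nearestNeighbors, closerPoints, Finset.mem_filter, Finset.mem_univ, true_and,
    Finset.card_filter]
  refine measurableSet_lt (Finset.measurable_sum _ fun j _ => ?_) measurable_const
  refine Measurable.ite ?_ measurable_const measurable_const
  exact (measurableSet_lt (hX j) (hX i)).union
    ((measurableSet_eq_fun (hX j) (hX i)).inter (measurableSet_lt (hU j) (hU i)))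

end Metric

theorem Finset.card_le_of_card_preceding_lt {α : Type*} [DecidableEq α] (S : Finset α) (r : α → ℝ)
    {k : ℕ} (h : ∀ i ∈ S, ((S.erase i).filter fun j => r j ≤ r i).card < k) : S.card ≤ k := by
  rcases S.eq_empty_or_nonempty with rfl | hS
  · simp
  obtain ⟨i, hi, hmax⟩ := S.exists_max_image r hS
  have := h i hi
  rw [Finset.filter_true_of_mem fun j hj => hmax j (Finset.mem_of_mem_erase hj),
    Finset.card_erase_of_mem hi] at this
  omega

section Normed

variable [NormedAddCommGroup E] [NormedSpace ℝ E]

theorem norm_sub_lt_of_same_cone {u v c : E} (hu : u ≠ 0) (huv : ‖u‖ ≤ ‖v‖)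
    (hcu : dist (‖u‖⁻¹ • u) c < 1 / 2) (hcv : dist (‖v‖⁻¹ • v) c < 1 / 2) :
    ‖v - u‖ < ‖v‖ := by
  have hu0 : 0 < ‖u‖ := norm_pos_iff.2 hu
  have hv0 : 0 < ‖v‖ := hu0.trans_le huv
  have h1 : ‖‖v‖⁻¹ • v - ‖u‖⁻¹ • u‖ < 1 := by
    rw [← dist_eq_norm]
    linarith [dist_triangle_right (‖v‖⁻¹ • v) (‖u‖⁻¹ • u) c]
  have h2 : v - u = ‖u‖ • (‖v‖⁻¹ • v - ‖u‖⁻¹ • u) + ((‖v‖ - ‖u‖) * ‖v‖⁻¹) • v := by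
    rw [smul_sub, smul_smul, smul_smul, mul_inv_cancel₀ hu0.ne', sub_mul,
      mul_inv_cancel₀ hv0.ne', sub_smul]
    module
  calc ‖v - u‖ ≤ ‖u‖ * ‖‖v‖⁻¹ • v - ‖u‖⁻¹ • u‖ + (‖v‖ - ‖u‖) * ‖v‖⁻¹ * ‖v‖ := by
        conv_lhs => rw [h2]
        refine (norm_add_le _ _).trans (le_of_eq ?_)
        rw [norm_smul, norm_smul, norm_norm, Real.norm_of_nonneg
          (mul_nonneg (sub_nonneg.2 huv) (inv_nonneg.2 hv0.le))]
    _ < ‖u‖ * 1 + (‖v‖ - ‖u‖) := by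
        rw [inv_mul_cancel_right₀ hv0.ne']
        gcongr
    _ = ‖v‖ := by ring

theorem exists_cone_cover (E : Type*) [NormedAddCommGroup E] [NormedSpace ℝ E]
    [FiniteDimensional ℝ E] :
    ∃ T : Finset E, ∀ v : E, v ≠ 0 → ∃ c ∈ T, dist (‖v‖⁻¹ • v) c < 1 / 2 := by
  obtain ⟨T, -, hT, hcov⟩ := (isCompact_sphere (0 : E) 1).finite_cover_balls
    (e := 1 / 2) (by norm_num)
  refine ⟨hT.toFinset, fun v hv => ?_⟩
  have : ‖v‖⁻¹ • v ∈ Metric.sphere (0 : E) 1 := by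
    rw [mem_sphere_zero_iff_norm, norm_smul, norm_inv, norm_norm,
      inv_mul_cancel₀ (norm_ne_zero_iff.2 hv)]
  simpa using hcov this

open Classical in
/-- A point is among the `k` nearest neighbors of at most `k` other points per cone. -/
theorem card_filter_mem_nearestNeighbors_update_le {T : Finset E}
    (hT : ∀ v : E, v ≠ 0 → ∃ c ∈ T, dist (‖v‖⁻¹ • v) c < 1 / 2)
    (k : ℕ) (s : Fin n → (E × Bool) × ℝ) (z : (E × Bool) × ℝ) :
    (Finset.univ.filter fun i : Fin n => (s i).1.1 ≠ z.1.1 ∧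
      i ∈ nearestNeighbors k (Function.update s i z) (s i).1.1).card ≤ T.card * k := by
  set G := Finset.univ.filter fun i : Fin n => (s i).1.1 ≠ z.1.1 ∧
      i ∈ nearestNeighbors k (Function.update s i z) (s i).1.1 with hG
  let v : Fin n → E := fun i => (s i).1.1 - z.1.1
  have hsub : G ⊆ T.biUnion fun c => G.filter fun i => dist (‖v i‖⁻¹ • v i) c < 1 / 2 := by
    intro i hi
    obtain ⟨c, hc, hic⟩ := hT (v i) (sub_ne_zero.2 (Finset.mem_filter.1 hi).2.1)
    exact Finset.mem_biUnion.2 ⟨c, hc, Finset.mem_filter.2 ⟨hi, hic⟩⟩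
  refine (Finset.card_le_card hsub).trans (Finset.card_biUnion_le_card_mul _ _ _ fun c _ => ?_)
  refine Finset.card_le_of_card_preceding_lt _ (fun i => ‖v i‖) fun i hi => ?_
  obtain ⟨hiG, hic⟩ := Finset.mem_filter.1 hi
  have hik := (Finset.mem_filter.1 (Finset.mem_filter.1 hiG).2.2).2
  refine lt_of_le_of_lt (Finset.card_le_card fun j hj => ?_) hik
  obtain ⟨hj, hji⟩ := Finset.mem_filter.1 hj
  obtain ⟨hne, hj⟩ := Finset.mem_erase.1 hj
  obtain ⟨hjG, hjc⟩ := Finset.mem_filter.1 hj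
  have := norm_sub_lt_of_same_cone (sub_ne_zero.2 (Finset.mem_filter.1 hjG).2.1) hji hjc hic
  simp only [closerPoints, Finset.mem_filter, Finset.mem_univ, true_and, Function.update_self,
    Function.update_of_ne hne]
  left
  simpa [v, dist_eq_norm] using this

end Normed

end NearestNeighbors

section Regression

/-- The label `±1` encoded by a Boolean. -/
def label (b : Bool) : ℝ := if b then 1 else -1

theorem abs_label (b : Bool) : |label b| = 1 := by cases b <;> simp [label]

theorem measurable_label : Measurable label := measurable_of_finite _

theorem abs_label_sub_le {E : Type*} {m : E → ℝ} (hm1 : ∀ x, |m x| ≤ 1) (b : Bool) (x : E) :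
    |label b - m x| ≤ 2 := by
  refine (abs_sub _ _).trans ?_
  rw [abs_label]
  linarith [hm1 x]

variable {E : Type*} [MeasurableSpace E]

/-- The regression function of the labels. -/
theorem exists_regression (P : Measure (E × Bool)) [IsProbabilityMeasure P] :
    ∃ m : E → ℝ, Measurable m ∧ (∀ x, |m x| ≤ 1) ∧
      ∀ (φ : E → ℝ) (C : ℝ), Measurable φ → (∀ x, |φ x| ≤ C) →
        ∫ p, φ p.1 * (label p.2 - m p.1) ∂P = 0 := by
  let m : E → ℝ := fun x => ∫ b, label b ∂(P.condKernel x)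
  have hm : Measurable m := by
    refine StronglyMeasurable.measurable ?_
    exact StronglyMeasurable.integral_kernel (f := label) measurable_label.stronglyMeasurable
  have hm1 : ∀ x, |m x| ≤ 1 := fun x => by
    have := norm_integral_le_of_norm_le_const (μ := P.condKernel x) (f := label) (C := 1)
      (.of_forall fun b => (abs_label b).le)
    rwa [Real.norm_eq_abs, probReal_univ, mul_one] at this
  refine ⟨m, hm, hm1, fun φ C hφ hC => ?_⟩
  have hmeas : Measurable fun p : E × Bool => φ p.1 * (label p.2 - m p.1) :=
    (hφ.comp measurable_fst).mul
      ((measurable_label.comp measurable_snd).sub (hm.comp measurable_fst))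
  rw [← Measure.integral_condKernel (Integrable.of_bound hmeas.aestronglyMeasurable (C * 2) <|
    .of_forall fun p => by
      rw [Real.norm_eq_abs, abs_mul]
      exact mul_le_mul (hC _) (abs_label_sub_le hm1 _ _) (abs_nonneg _)
        ((abs_nonneg _).trans (hC p.1)))]
  refine (integral_congr_ae (.of_forall fun x => ?_)).trans (integral_zero _ _)
  have hi : Integrable label (P.condKernel x) :=
    Integrable.of_bound measurable_label.aestronglyMeasurable 1 (.of_forall fun b => (abs_label b).le)
  simp only
  rw [integral_const_mul, integral_sub hi (integrable_const _),
    integral_const, probReal_univ, one_smul]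
  exact mul_eq_zero_of_right _ (sub_self _)

/-- The law `Q` of a labeled sample point with auxiliary variable has regression function `m`. -/
structure IsRegression (Q : Measure ((E × Bool) × ℝ)) (m : E → ℝ) : Prop where
  measurable : Measurable m
  abs_le_one : ∀ x, |m x| ≤ 1
  integral_eq_zero : ∀ (φ : E × ℝ → ℝ) (C : ℝ), Measurable φ → (∀ x, |φ x| ≤ C) →
    ∫ z, φ (z.1.1, z.2) * (label z.1.2 - m z.1.1) ∂Q = 0

theorem exists_isRegression_prod (P : Measure (E × Bool)) [IsProbabilityMeasure P]
    (ν : Measure ℝ) [IsProbabilityMeasure ν] : ∃ m : E → ℝ, IsRegression (P.prod ν) m := by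
  obtain ⟨m, hm, hm1, h⟩ := exists_regression P
  refine ⟨m, hm, hm1, fun φ C hφ hC => ?_⟩
  have hmeas : Measurable fun z : (E × Bool) × ℝ =>
      φ (z.1.1, z.2) * (label z.1.2 - m z.1.1) :=
    (hφ.comp (by fun_prop)).mul ((measurable_label.comp (by fun_prop)).sub (hm.comp (by fun_prop)))
  rw [integral_prod_symm _ (Integrable.of_bound hmeas.aestronglyMeasurable (C * 2) <|
    .of_forall fun p => by
      rw [Real.norm_eq_abs, abs_mul]
      exact mul_le_mul (hC _) (abs_label_sub_le hm1 _ _) (abs_nonneg _)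
        ((abs_nonneg _).trans (hC (p.1.1, p.2))))]
  refine (integral_congr_ae (.of_forall fun u => ?_)).trans (integral_zero _ _)
  exact h (fun x => φ (x, u)) C (hφ.comp (by fun_prop)) fun x => hC _

end Regression

section Noise

variable {E : Type*} [MetricSpace E] [MeasurableSpace E] [BorelSpace E]
  [SecondCountableTopology E] {Q : Measure ((E × Bool) × ℝ)} [IsProbabilityMeasure Q]

theorem integral_sq_noise_le (hU : ∀ c, Q (Prod.snd ⁻¹' {c}) = 0) {m : E → ℝ}
    (hm : IsRegression Q m) {n k : ℕ} (hkn : k ≤ n) (x : E) :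
    ∫ s, (∑ i, if i ∈ nearestNeighbors k s x then label (s i).1.2 - m (s i).1.1 else 0) ^ 2
      ∂(Measure.pi fun _ : Fin n => Q) ≤ 4 * k := by
  let D : (E × Bool) × ℝ → ℝ := fun z => label z.1.2 - m z.1.1
  let F : Fin n → (Fin n → (E × Bool) × ℝ) → ℝ := fun i s =>
    if i ∈ nearestNeighbors k s x then D (s i) else 0
  have hD : Measurable D :=
    (measurable_label.comp (by fun_prop)).sub (hm.measurable.comp (by fun_prop))
  have hD2 : ∀ z, |D z| ≤ 2 := fun z => abs_label_sub_le hm.abs_le_one _ _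
  have hset : ∀ i, MeasurableSet
      {s : Fin n → (E × Bool) × ℝ | i ∈ nearestNeighbors k s x} := fun i =>
    measurableSet_mem_nearestNeighbors measurable_id measurable_const k i
  have hF : ∀ i, Measurable (F i) := fun i =>
    Measurable.ite (hset i) (hD.comp (measurable_pi_apply i)) measurable_const
  have hF2 : ∀ i s, |F i s| ≤ 2 := fun i s => by
    simp only [F]
    split_ifs
    · exact hD2 _
    · simp
  have horth : ∀ i j, i ≠ j → ∫ s, F i s * F j s ∂(Measure.pi fun _ : Fin n => Q) = 0 := by
    intro i j hij
    refine integral_pi_eq_zero_of_update i (Integrable.of_bound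
      ((hF i).mul (hF j)).aestronglyMeasurable (2 * 2) <| .of_forall fun s => ?_) fun s => ?_
    · rw [Real.norm_eq_abs, abs_mul]
      exact mul_le_mul (hF2 i s) (hF2 j s) (abs_nonneg _) (by norm_num)
    · let u : E × ℝ → Fin n → (E × Bool) × ℝ := fun w =>
        Function.update s i ((w.1, true), w.2)
      have hu : Measurable u := (measurable_update s).comp (by fun_prop)
      let φ : E × ℝ → ℝ := fun w =>
        if i ∈ nearestNeighbors k (u w) x ∧ j ∈ nearestNeighbors k (u w) x then D (s j) else 0
      have hφ : Measurable φ := Measurable.ite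
        ((measurableSet_mem_nearestNeighbors hu measurable_const k i).inter
          (measurableSet_mem_nearestNeighbors hu measurable_const k j))
        measurable_const measurable_const
      refine (integral_congr_ae (.of_forall fun z => ?_)).trans
        (hm.integral_eq_zero φ 2 hφ fun w => ?_)
      · have hN : nearestNeighbors k (Function.update s i z) x
            = nearestNeighbors k (u (z.1.1, z.2)) x := by
          refine nearestNeighbors_congr (fun l => ?_) (fun l => ?_) k x <;>
          · by_cases h : l = i
            · subst h; simp [u]
            · simp [u, h]
        simp only [F, φ, hN, Function.update_self, Function.update_of_ne hij.symm]
        by_cases h1 : i ∈ nearestNeighbors k (u (z.1.1, z.2)) x <;>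
        by_cases h2 : j ∈ nearestNeighbors k (u (z.1.1, z.2)) x <;> simp [h1, h2, D, mul_comm]
      · simp only [φ]
        split_ifs
        · exact hD2 _
        · simp
  have hle : ∀ i, Integrable (fun s => F i s ^ 2) (Measure.pi fun _ : Fin n => Q) := fun i =>
    Integrable.of_bound ((hF i).pow_const 2).aestronglyMeasurable (2 ^ 2) <| .of_forall fun s => by
      rw [Real.norm_eq_abs, abs_pow]
      gcongr
      exact hF2 i s
  change ∫ s, (∑ i, F i s) ^ 2 ∂_ ≤ _
  rw [integral_sq_sum_of_orthogonal hF hF2 horth, ← integral_finsetSum _ fun i _ => hle i]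
  calc ∫ s, ∑ i, F i s ^ 2 ∂(Measure.pi fun _ : Fin n => Q)
      ≤ ∫ s, (4 * k : ℝ) ∂(Measure.pi fun _ : Fin n => Q) := by
        refine integral_mono_ae (integrable_finsetSum _ fun i _ => hle i) (integrable_const _) ?_
        filter_upwards [ae_pi_injective (ι := Fin n) measurable_snd hU] with s hs
        calc ∑ i, F i s ^ 2 ≤ ∑ i, if i ∈ nearestNeighbors k s x then (4 : ℝ) else 0 := by
              gcongr with i
              simp only [F]
              split_ifs
              · nlinarith [sq_abs (D (s i)), hD2 (s i), abs_nonneg (D (s i))]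
              · simp
          _ = 4 * k := by
              rw [Finset.sum_ite_mem, Finset.univ_inter, Finset.sum_const,
                card_nearestNeighbors hs hkn, nsmul_eq_mul, mul_comm]
    _ = 4 * k := by simp

theorem lintegral_enorm_noise_le (hU : ∀ c, Q (Prod.snd ⁻¹' {c}) = 0) {m : E → ℝ}
    (hm : IsRegression Q m) {n k : ℕ} (hk : 0 < k) (hkn : k ≤ n) (x : E) :
    ∫⁻ s, ‖(k : ℝ)⁻¹ *
        ∑ i, if i ∈ nearestNeighbors k s x then label (s i).1.2 - m (s i).1.1 else 0‖ₑ
      ∂(Measure.pi fun _ : Fin n => Q) ≤ ENNReal.ofReal (5 / √k) := by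
  let G : (Fin n → (E × Bool) × ℝ) → ℝ := fun s =>
    ∑ i, if i ∈ nearestNeighbors k s x then label (s i).1.2 - m (s i).1.1 else 0
  have hG : Measurable G := Finset.measurable_sum _ fun i _ =>
    Measurable.ite (measurableSet_mem_nearestNeighbors measurable_id measurable_const k i)
      ((measurable_label.comp (by fun_prop)).sub (hm.measurable.comp (by fun_prop)))
      measurable_const
  have hGn : ∀ s, |G s| ≤ n * 2 := fun s => by
    refine (Finset.abs_sum_le_sum_abs _ _).trans ?_
    refine (Finset.sum_le_card_nsmul _ _ 2 fun i _ => ?_).trans (by simp)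
    split_ifs
    · exact abs_label_sub_le hm.abs_le_one _ _
    · simp
  have hk0 : (0 : ℝ) < k := by exact_mod_cast hk
  have hr : 0 < √(k : ℝ) := Real.sqrt_pos.2 hk0
  have hrr : √(k : ℝ) * √(k : ℝ) = k := Real.mul_self_sqrt hk0.le
  have hi1 : Integrable (fun s => (k : ℝ)⁻¹ * G s) (Measure.pi fun _ : Fin n => Q) :=
    (Integrable.of_bound hG.aestronglyMeasurable (n * 2) (.of_forall hGn)).const_mul _
  have hi2 : Integrable (fun s => G s ^ 2) (Measure.pi fun _ : Fin n => Q) :=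
    Integrable.of_bound (hG.pow_const 2).aestronglyMeasurable ((n * 2) ^ 2) <|
      .of_forall fun s => by
        rw [Real.norm_eq_abs, abs_pow]
        gcongr
        exact hGn s
  rw [← ofReal_integral_norm_eq_lintegral_enorm hi1]
  refine ENNReal.ofReal_le_ofReal ?_
  calc ∫ s, ‖(k : ℝ)⁻¹ * G s‖ ∂(Measure.pi fun _ : Fin n => Q)
      ≤ ∫ s, ((k * √k)⁻¹ * G s ^ 2 + (√k)⁻¹) ∂(Measure.pi fun _ : Fin n => Q) := by
        refine integral_mono hi1.norm ((hi2.const_mul _).add (integrable_const _)) fun s => ?_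
        simp only [norm_mul, norm_inv, Real.norm_eq_abs, Nat.abs_cast]
        have : (k * √k)⁻¹ * G s ^ 2 + (√k)⁻¹ - (k : ℝ)⁻¹ * |G s|
            = (k * √k)⁻¹ * ((|G s| - √k / 2) ^ 2 + 3 / 4 * (√k * √k)) := by
          rw [← sq_abs]
          field_simp
          linear_combination (-16 : ℝ) * hrr
        have h0 : 0 ≤ (k * √k)⁻¹ * ((|G s| - √k / 2) ^ 2 + 3 / 4 * (√k * √k)) := by positivity
        linarith
    _ ≤ (k * √k)⁻¹ * (4 * k) + (√k)⁻¹ := by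
        rw [integral_add (hi2.const_mul _) (integrable_const _), integral_const_mul]
        simp only [integral_const, probReal_univ, one_smul]
        gcongr
        exact integral_sq_noise_le hU hm hkn x
    _ = 5 / √k := by field_simp; ring

end Noise

section StoneLemma

variable {E : Type*} [NormedAddCommGroup E] [NormedSpace ℝ E] [FiniteDimensional ℝ E]
  [MeasurableSpace E] [BorelSpace E] {Q : Measure ((E × Bool) × ℝ)} [IsProbabilityMeasure Q]

/-- **Stone's lemma.** -/
theorem lintegral_sum_nearestNeighbors_le (hU : ∀ c, Q (Prod.snd ⁻¹' {c}) = 0) {T : Finset E}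
    (hT : ∀ v : E, v ≠ 0 → ∃ c ∈ T, dist (‖v‖⁻¹ • v) c < 1 / 2)
    {n k : ℕ} (hkn : k ≤ n) {h : E → ENNReal} (hh : Measurable h) :
    ∫⁻ q, ∑ i ∈ nearestNeighbors k q.2 q.1.1.1, h (q.2 i).1.1
      ∂(Q.prod (Measure.pi fun _ : Fin n => Q)) ≤ (T.card + 1) * k * ∫⁻ z, h z.1.1 ∂Q := by
  classical
  let V : Measure (((E × Bool) × ℝ) × (Fin n → (E × Bool) × ℝ)) := Q.prod (Measure.pi fun _ : Fin n => Q)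
  let G : Fin n → ((E × Bool) × ℝ) × (Fin n → (E × Bool) × ℝ) → ENNReal := fun i q =>
    if (q.2 i).1.1 ≠ q.1.1.1 ∧ i ∈ nearestNeighbors k q.2 q.1.1.1 then h (q.2 i).1.1 else 0
  have hG : ∀ i, Measurable (G i) := fun i => by
    refine Measurable.ite ?_ (hh.comp (by fun_prop)) measurable_const
    exact (measurableSet_eq_fun (by fun_prop) (by fun_prop)).compl.inter
      (measurableSet_mem_nearestNeighbors measurable_snd (by fun_prop) k i)
  have hhz : Measurable fun q : ((E × Bool) × ℝ) × (Fin n → (E × Bool) × ℝ) => h q.1.1.1 := hh.comp (by fun_prop)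
  have hV : ∫⁻ q, h q.1.1.1 ∂V = ∫⁻ z, h z.1.1 ∂Q := by
    rw [lintegral_prod _ hhz.aemeasurable]
    simp
  have hinj : ∀ᵐ q ∂V, Function.Injective fun i => (q.2 i).2 :=
    Measure.quasiMeasurePreserving_snd.ae (ae_pi_injective measurable_snd hU)
  have hsplit : ∀ᵐ q ∂V, ∑ i ∈ nearestNeighbors k q.2 q.1.1.1, h (q.2 i).1.1
      ≤ ∑ i, G i q + k * h q.1.1.1 := by
    filter_upwards [hinj] with q hq
    calc ∑ i ∈ nearestNeighbors k q.2 q.1.1.1, h (q.2 i).1.1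
        ≤ ∑ i ∈ nearestNeighbors k q.2 q.1.1.1, (G i q + h q.1.1.1) := by
          refine Finset.sum_le_sum fun i hi => ?_
          by_cases hx : (q.2 i).1.1 = q.1.1.1
          · rw [hx]; exact le_add_self
          · simp only [G, if_pos (And.intro hx hi)]; exact le_self_add
      _ ≤ ∑ i, G i q + k * h q.1.1.1 := by
          rw [Finset.sum_add_distrib, Finset.sum_const, card_nearestNeighbors hq hkn, nsmul_eq_mul]
          gcongr
          exact Finset.subset_univ _
  have hexch : ∫⁻ q, ∑ i, G i q ∂V ≤ T.card * k * ∫⁻ z, h z.1.1 ∂Q := by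
    rw [lintegral_finsetSum _ fun i _ => hG i]
    have : ∀ i, ∫⁻ q, G i q ∂V = ∫⁻ q, G i (q.2 i, Function.update q.2 i q.1) ∂V := fun i =>
      ((measurePreserving_exchange Q i).lintegral_comp (hG i)).symm
    simp_rw [this]
    have hG' : ∀ i, Measurable fun q : ((E × Bool) × ℝ) × (Fin n → (E × Bool) × ℝ) =>
        G i (q.2 i, Function.update q.2 i q.1) := fun i =>
      (hG i).comp (measurePreserving_exchange Q i).measurable
    rw [← lintegral_finsetSum _ fun i _ => hG' i, ← hV, ← lintegral_const_mul _ hhz]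
    refine lintegral_mono fun q => ?_
    simp only [G, Function.update_self]
    rw [← Finset.sum_filter, Finset.sum_const, nsmul_eq_mul]
    gcongr
    have := card_filter_mem_nearestNeighbors_update_le hT k q.2 q.1
    simp only [ne_comm (a := q.1.1.1)]
    exact_mod_cast this
  calc ∫⁻ q, ∑ i ∈ nearestNeighbors k q.2 q.1.1.1, h (q.2 i).1.1 ∂V
      ≤ ∫⁻ q, (∑ i, G i q + k * h q.1.1.1) ∂V := lintegral_mono_ae hsplit
    _ = ∫⁻ q, ∑ i, G i q ∂V + k * ∫⁻ z, h z.1.1 ∂Q := by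
        rw [lintegral_add_right _ (hhz.const_mul _), lintegral_const_mul _ hhz, hV]
    _ ≤ T.card * k * ∫⁻ z, h z.1.1 ∂Q + k * ∫⁻ z, h z.1.1 ∂Q := by gcongr
    _ = (T.card + 1) * k * ∫⁻ z, h z.1.1 ∂Q := by ring

end StoneLemma

section SparseBalls

theorem tendsto_pi_card_filter_lt {Z : Type*} [MeasurableSpace Z] {Q : Measure Z}
    [IsProbabilityMeasure Q] {A : Set Z} [DecidablePred (· ∈ A)] (hA : MeasurableSet A)
    (hQA : Q A ≠ 0) {k : ℕ → ℕ}
    (hkn : Tendsto (fun n : ℕ => (k n : ℝ) / n) atTop (nhds 0)) :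
    Tendsto (fun n => (Measure.pi fun _ : Fin n => Q)
      {s | (Finset.univ.filter fun j => s j ∈ A).card < k n}) atTop (nhds 0) := by
  set p := Q.real A with hp
  have hp0 : 0 < p := ENNReal.toReal_pos hQA (measure_ne_top _ _)
  have hp1 : p ≤ 1 := measureReal_le_one
  have hlim : Tendsto (fun n : ℕ => ENNReal.ofReal (4 / p ^ 2 / n)) atTop (nhds 0) := by
    rw [← ENNReal.ofReal_zero]
    exact ENNReal.tendsto_ofReal (tendsto_const_div_atTop_nhds_zero_nat _)
  refine tendsto_of_tendsto_of_tendsto_of_le_of_le' tendsto_const_nhds hlim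
    (.of_forall fun _ => zero_le) ?_
  filter_upwards [hkn.eventually_lt_const (half_pos hp0), eventually_gt_atTop 0] with n hn hn0
  have hn0' : (0 : ℝ) < n := by exact_mod_cast hn0
  rw [div_lt_iff₀ hn0'] at hn
  let f : Z → ℝ := fun z => (if z ∈ A then 1 else 0) - p
  have hf : Measurable f := (Measurable.ite hA measurable_const measurable_const).sub_const p
  have hf1 : ∀ z, |f z| ≤ 1 := fun z => by
    simp only [f]
    split_ifs <;> rw [abs_le] <;> constructor <;> linarith
  have hf0 : ∫ z, f z ∂Q = 0 := by
    have : ∫ z, (if z ∈ A then (1 : ℝ) else 0) ∂Q = p := by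
      rw [hp, ← integral_indicator_one hA]
      congr 1 with z
      simp [Set.indicator_apply]
    simp only [f]
    rw [integral_sub _ (integrable_const _), this]
    · simp
    · exact Integrable.of_bound
        (Measurable.ite hA measurable_const measurable_const).aestronglyMeasurable 1
        (.of_forall fun z => by split_ifs <;> simp)
  let F : Fin n → (Fin n → Z) → ℝ := fun i s => f (s i)
  have hF : ∀ i, Measurable (F i) := fun i => hf.comp (measurable_pi_apply i)
  have hS : Measurable fun s => (∑ i, F i s) ^ 2 :=
    (Finset.measurable_sum _ fun i _ => hF i).pow_const 2
  have hvar : ∫ s, (∑ i, F i s) ^ 2 ∂(Measure.pi fun _ : Fin n => Q) ≤ n := by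
    rw [integral_sq_sum_of_orthogonal hF (fun i s => hf1 (s i))]
    · refine (Finset.sum_le_card_nsmul _ _ 1 fun i _ => ?_).trans (by simp)
      refine (integral_mono_of_nonneg (.of_forall fun s => sq_nonneg _) (integrable_const 1)
        (.of_forall fun s => ?_)).trans (by simp)
      exact (sq_le_one_iff_abs_le_one _).2 (hf1 _)
    · intro i j hij
      refine integral_pi_eq_zero_of_update i (Integrable.of_bound
        ((hF i).mul (hF j)).aestronglyMeasurable (1 * 1) <| .of_forall fun s => ?_) fun s => ?_
      · rw [Real.norm_eq_abs, abs_mul]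
        exact mul_le_mul (hf1 _) (hf1 _) (abs_nonneg _) (by norm_num)
      · simp only [F, Function.update_self, Function.update_of_ne hij.symm]
        rw [integral_mul_const, hf0, zero_mul]
  have hmarkov := mul_meas_ge_le_integral_of_nonneg (μ := Measure.pi fun _ : Fin n => Q)
    (f := fun s => (∑ i, F i s) ^ 2) (.of_forall fun s => sq_nonneg _)
    (Integrable.of_bound hS.aestronglyMeasurable ((n : ℝ) ^ 2) <| .of_forall fun s => by
      rw [Real.norm_eq_abs, abs_pow]
      gcongr
      refine (Finset.abs_sum_le_sum_abs _ _).trans ?_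
      exact (Finset.sum_le_card_nsmul _ _ 1 fun i _ => hf1 _).trans (by simp))
    ((n * p / 2) ^ 2)
  have hsub : {s : Fin n → Z | (Finset.univ.filter fun j => s j ∈ A).card < k n}
      ⊆ {s | (n * p / 2) ^ 2 ≤ (∑ i, F i s) ^ 2} := by
    intro s hs
    have hs' : ((Finset.univ.filter fun j => s j ∈ A).card : ℝ) ≤ k n := by
      exact_mod_cast (Set.mem_ofPred_eq ▸ hs).le
    have hsum : ∑ i, F i s = (Finset.univ.filter fun j => s j ∈ A).card - n * p := by
      simp [F, f, Finset.sum_sub_distrib]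
    rw [Set.mem_ofPred_eq, hsum]
    have : 0 < n * p := by positivity
    nlinarith
  refine (measure_mono hsub).trans ?_
  rw [← ofReal_measureReal]
  refine ENNReal.ofReal_le_ofReal ?_
  have hpos : 0 < (n * p / 2) ^ 2 := by positivity
  calc _ ≤ n / (n * p / 2) ^ 2 := by
        rw [le_div_iff₀' hpos]
        exact hmarkov.trans hvar
    _ = 4 / p ^ 2 / n := by field_simp; norm_num

variable {E : Type*} [MetricSpace E] [MeasurableSpace E] [BorelSpace E]
  [SecondCountableTopology E] {Q : Measure ((E × Bool) × ℝ)} [IsProbabilityMeasure Q]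

theorem measurableSet_card_ball_lt (n k : ℕ) (δ : ℝ) :
    MeasurableSet {q : ((E × Bool) × ℝ) × (Fin n → (E × Bool) × ℝ) |
      (Finset.univ.filter fun j : Fin n => dist q.1.1.1 (q.2 j).1.1 < δ).card < k} := by
  simp only [Finset.card_filter]
  refine measurableSet_lt (Finset.measurable_sum _ fun j _ => ?_) measurable_const
  exact Measurable.ite (measurableSet_lt (Measurable.dist (by fun_prop) (by fun_prop))
    measurable_const) measurable_const measurable_const

theorem tendsto_prod_card_ball_lt {k : ℕ → ℕ}
    (hkn : Tendsto (fun n : ℕ => (k n : ℝ) / n) atTop (nhds 0)) {δ : ℝ} (hδ : 0 < δ) :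
    Tendsto (fun n => (Q.prod (Measure.pi fun _ : Fin n => Q))
      {q | (Finset.univ.filter fun j : Fin n => dist q.1.1.1 (q.2 j).1.1 < δ).card < k n})
      atTop (nhds 0) := by
  simp_rw [fun n => Measure.prod_apply (μ := Q) (ν := Measure.pi fun _ : Fin n => Q)
    (measurableSet_card_ball_lt (E := E) n (k n) δ)]
  rw [← lintegral_zero (μ := Q)]
  refine tendsto_lintegral_of_dominated_convergence (fun _ => 1)
    (fun n => measurable_measure_prodMk_left (measurableSet_card_ball_lt n (k n) δ))
    (fun n => .of_forall fun z => prob_le_one) (by simp) ?_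
  have hX : Measurable fun z : (E × Bool) × ℝ => z.1.1 := by fun_prop
  have hsupp : ∀ᵐ z ∂Q, z.1.1 ∈ (Q.map fun z => z.1.1).support :=
    ae_of_ae_map hX.aemeasurable Measure.support_mem_ae
  classical
  filter_upwards [hsupp] with z hz
  have hpos := (Measure.mem_support_iff_forall _).1 hz _ (Metric.ball_mem_nhds _ hδ)
  rw [Measure.map_apply hX measurableSet_ball] at hpos
  have := tendsto_pi_card_filter_lt (hX measurableSet_ball) hpos.ne' hkn
  simpa [dist_comm] using this

end SparseBalls

section Consistency

/-- The normalized sum of the labels of the `k` nearest neighbors of `x`. -/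
noncomputable def knnAverage {E : Type*} [MetricSpace E] {n : ℕ} (k : ℕ)
    (s : Fin n → (E × Bool) × ℝ) (x : E) : ℝ :=
  (k : ℝ)⁻¹ * ∑ i ∈ nearestNeighbors k s x, label (s i).1.2

theorem measurable_knnAverage {E Ω : Type*} [MetricSpace E] [MeasurableSpace E] [BorelSpace E]
    [SecondCountableTopology E] [MeasurableSpace Ω] {n k : ℕ}
    {S : Ω → Fin n → (E × Bool) × ℝ} {x : Ω → E} (hS : Measurable S) (hx : Measurable x) :
    Measurable fun ω => knnAverage k (S ω) (x ω) := by
  unfold knnAverage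
  have : ∀ ω, ∑ i ∈ nearestNeighbors k (S ω) (x ω), label (S ω i).1.2
      = ∑ i, if i ∈ nearestNeighbors k (S ω) (x ω) then label (S ω i).1.2 else 0 := fun ω => by
    rw [Finset.sum_ite_mem, Finset.univ_inter]
  simp_rw [this]
  refine (Finset.measurable_sum _ fun i _ => ?_).const_mul _
  exact Measurable.ite (measurableSet_mem_nearestNeighbors hS hx k i)
    (measurable_label.comp (by fun_prop)) measurable_const

theorem enorm_knnAverage_sub_le {E : Type*} [MetricSpace E] {n k : ℕ} (hk : 0 < k) (hkn : k ≤ n)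
    {s : Fin n → (E × Bool) × ℝ} (hs : Function.Injective fun i => (s i).2) {m g : E → ℝ}
    {ε δ M : ℝ} (hM : ∀ x, |g x| ≤ M) (hg : ∀ x y, dist x y < δ → dist (g x) (g y) < ε) (x : E) :
    ‖knnAverage k s x - m x‖ₑ ≤
      ‖(k : ℝ)⁻¹ *
        ∑ i, if i ∈ nearestNeighbors k s x then label (s i).1.2 - m (s i).1.1 else 0‖ₑ
      + (k : ENNReal)⁻¹ * ∑ i ∈ nearestNeighbors k s x, ‖m (s i).1.1 - g (s i).1.1‖ₑ
      + (‖m x - g x‖ₑ + ENNReal.ofReal ε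
        + if (Finset.univ.filter fun j : Fin n => dist x (s j).1.1 < δ).card < k
          then ENNReal.ofReal (2 * M) else 0) := by
  have hcard := card_nearestNeighbors hs hkn x
  have hk0 : (k : ℝ) ≠ 0 := by exact_mod_cast hk.ne'
  have hk0' : (k : ENNReal) ≠ 0 := by exact_mod_cast hk.ne'
  set R : ENNReal := ‖m x - g x‖ₑ + ENNReal.ofReal ε
        + if (Finset.univ.filter fun j : Fin n => dist x (s j).1.1 < δ).card < k
          then ENNReal.ofReal (2 * M) else 0 with hR
  have hdecomp : knnAverage k s x - m x = (k : ℝ)⁻¹ *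
        (∑ i, if i ∈ nearestNeighbors k s x then label (s i).1.2 - m (s i).1.1 else 0)
      + (k : ℝ)⁻¹ * ∑ i ∈ nearestNeighbors k s x, (m (s i).1.1 - m x) := by
    rw [Finset.sum_ite_mem, Finset.univ_inter, Finset.sum_sub_distrib, Finset.sum_sub_distrib,
      Finset.sum_const, hcard, nsmul_eq_mul, knnAverage]
    field_simp
    ring
  have hterm : ∀ i ∈ nearestNeighbors k s x,
      ‖m (s i).1.1 - m x‖ₑ ≤ ‖m (s i).1.1 - g (s i).1.1‖ₑ + R := by
    intro i hi
    have h1 : m (s i).1.1 - m x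
        = (m (s i).1.1 - g (s i).1.1) + ((g x - m x) + (g (s i).1.1 - g x)) := by ring
    have h2 : ‖g (s i).1.1 - g x‖ₑ ≤ ENNReal.ofReal ε
        + if (Finset.univ.filter fun j : Fin n => dist x (s j).1.1 < δ).card < k
          then ENNReal.ofReal (2 * M) else 0 := by
      rw [← ofReal_norm]
      by_cases hd : dist x (s i).1.1 < δ
      · refine le_add_right (ENNReal.ofReal_le_ofReal ?_)
        rw [← dist_eq_norm, dist_comm]
        exact (hg _ _ hd).le
      · rw [if_pos (card_ball_lt_of_mem_nearestNeighbors hi (not_lt.1 hd))]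
        refine le_add_left (ENNReal.ofReal_le_ofReal ?_)
        rw [Real.norm_eq_abs]
        refine (abs_sub _ _).trans ?_
        linarith [hM (s i).1.1, hM x]
    rw [h1]
    refine (enorm_add_le _ _).trans (add_le_add_right ((enorm_add_le _ _).trans ?_) _)
    rw [hR, add_assoc, enorm_sub_rev]
    gcongr
  rw [hdecomp, add_assoc]
  refine (enorm_add_le _ _).trans (add_le_add_right ?_ _)
  rw [enorm_mul, enorm_inv hk0, show ‖(k : ℝ)‖ₑ = (k : ENNReal) by simp]
  calc (k : ENNReal)⁻¹ * ‖∑ i ∈ nearestNeighbors k s x, (m (s i).1.1 - m x)‖ₑ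
      ≤ (k : ENNReal)⁻¹ *
          ∑ i ∈ nearestNeighbors k s x, (‖m (s i).1.1 - g (s i).1.1‖ₑ + R) := by
        gcongr
        exact (enorm_sum_le _ _).trans (Finset.sum_le_sum hterm)
    _ = (k : ENNReal)⁻¹ * ∑ i ∈ nearestNeighbors k s x, ‖m (s i).1.1 - g (s i).1.1‖ₑ + R := by
        rw [Finset.sum_add_distrib, Finset.sum_const, hcard, nsmul_eq_mul, mul_add, ← mul_assoc,
          ENNReal.inv_mul_cancel hk0' (ENNReal.natCast_ne_top k), one_mul]

variable {E : Type*} [NormedAddCommGroup E] [NormedSpace ℝ E] [FiniteDimensional ℝ E]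
  [MeasurableSpace E] [BorelSpace E] {Q : Measure ((E × Bool) × ℝ)} [IsProbabilityMeasure Q]

theorem lintegral_enorm_knnAverage_sub_le (hU : ∀ c, Q (Prod.snd ⁻¹' {c}) = 0) {m : E → ℝ}
    (hm : IsRegression Q m) {T : Finset E}
    (hT : ∀ v : E, v ≠ 0 → ∃ c ∈ T, dist (‖v‖⁻¹ • v) c < 1 / 2)
    {n k : ℕ} (hk : 0 < k) (hkn : k ≤ n) {g : E → ℝ} (hgm : Measurable g) {ε δ M : ℝ}
    (hM : ∀ x, |g x| ≤ M) (hg : ∀ x y, dist x y < δ → dist (g x) (g y) < ε) :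
    ∫⁻ q, ‖knnAverage k q.2 q.1.1.1 - m q.1.1.1‖ₑ ∂(Q.prod (Measure.pi fun _ : Fin n => Q)) ≤
      ENNReal.ofReal (5 / √k) + (T.card + 2) * ∫⁻ z, ‖m z.1.1 - g z.1.1‖ₑ ∂Q + ENNReal.ofReal ε
      + ENNReal.ofReal (2 * M) * (Q.prod (Measure.pi fun _ : Fin n => Q))
          {q | (Finset.univ.filter fun j : Fin n => dist q.1.1.1 (q.2 j).1.1 < δ).card < k} := by
  let V := Q.prod (Measure.pi fun _ : Fin n => Q)
  let h : E → ENNReal := fun x => ‖m x - g x‖ₑ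
  have hh : Measurable h := (hm.measurable.sub hgm).enorm
  have hk0' : (k : ENNReal) ≠ 0 := by exact_mod_cast hk.ne'
  let N : ((E × Bool) × ℝ) × (Fin n → (E × Bool) × ℝ) → ENNReal := fun q => ‖(k : ℝ)⁻¹ *
    ∑ i, if i ∈ nearestNeighbors k q.2 q.1.1.1 then label (q.2 i).1.2 - m (q.2 i).1.1 else 0‖ₑ
  let B := {q : ((E × Bool) × ℝ) × (Fin n → (E × Bool) × ℝ) |
    (Finset.univ.filter fun j : Fin n => dist q.1.1.1 (q.2 j).1.1 < δ).card < k}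
  have hB : MeasurableSet B := measurableSet_card_ball_lt n k δ
  have hN : Measurable N := by
    refine Measurable.enorm ((Finset.measurable_sum _ fun i _ => ?_).const_mul _)
    exact Measurable.ite (measurableSet_mem_nearestNeighbors measurable_snd (by fun_prop) k i)
      ((measurable_label.comp (by fun_prop)).sub (hm.measurable.comp (by fun_prop)))
      measurable_const
  have hNle : ∫⁻ q, N q ∂V ≤ ENNReal.ofReal (5 / √k) := by
    rw [lintegral_prod _ hN.aemeasurable]
    refine (lintegral_mono (g := fun _ => ENNReal.ofReal (5 / √k)) fun z => ?_).trans (by simp)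
    exact lintegral_enorm_noise_le hU hm hk hkn z.1.1
  have hhz : Measurable fun q : ((E × Bool) × ℝ) × (Fin n → (E × Bool) × ℝ) => h q.1.1.1 :=
    hh.comp (by fun_prop)
  have hV : ∫⁻ q, h q.1.1.1 ∂V = ∫⁻ z, h z.1.1 ∂Q := by
    rw [lintegral_prod _ hhz.aemeasurable]
    simp
  have hstone := lintegral_sum_nearestNeighbors_le hU hT hkn hh
  have hinj : ∀ᵐ q ∂V, Function.Injective fun i => (q.2 i).2 :=
    Measure.quasiMeasurePreserving_snd.ae (ae_pi_injective measurable_snd hU)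
  calc ∫⁻ q, ‖knnAverage k q.2 q.1.1.1 - m q.1.1.1‖ₑ ∂V
      ≤ ∫⁻ q, (N q + (k : ENNReal)⁻¹ * (∑ i ∈ nearestNeighbors k q.2 q.1.1.1, h (q.2 i).1.1)
          + (h q.1.1.1 + ENNReal.ofReal ε
            + B.indicator (fun _ => ENNReal.ofReal (2 * M)) q)) ∂V := by
        refine lintegral_mono_ae ?_
        filter_upwards [hinj] with q hq
        refine (enorm_knnAverage_sub_le hk hkn hq hM hg q.1.1.1).trans (le_of_eq ?_)
        simp [N, h, B, Set.indicator_apply]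
    _ = ∫⁻ q, N q ∂V + (k : ENNReal)⁻¹ *
            ∫⁻ q, (∑ i ∈ nearestNeighbors k q.2 q.1.1.1, h (q.2 i).1.1) ∂V
          + (∫⁻ z, h z.1.1 ∂Q + ENNReal.ofReal ε + ENNReal.ofReal (2 * M) * V B) := by
        have hR : Measurable fun q => h q.1.1.1 + ENNReal.ofReal ε
            + B.indicator (fun _ => ENNReal.ofReal (2 * M)) q :=
          (hhz.add_const _).add (measurable_const.indicator hB)
        rw [lintegral_add_right _ hR,
          lintegral_add_left hN, lintegral_const_mul' _ _ (ENNReal.inv_ne_top.2 hk0'),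
          lintegral_add_right _ (measurable_const.indicator hB),
          lintegral_add_right _ measurable_const, hV, lintegral_indicator_const hB]
        simp [V]
    _ ≤ ENNReal.ofReal (5 / √k) + (k : ENNReal)⁻¹ * ((T.card + 1) * k * ∫⁻ z, h z.1.1 ∂Q)
          + (∫⁻ z, h z.1.1 ∂Q + ENNReal.ofReal ε + ENNReal.ofReal (2 * M) * V B) := by
        gcongr
    _ = ENNReal.ofReal (5 / √k) + (T.card + 2) * ∫⁻ z, h z.1.1 ∂Q + ENNReal.ofReal ε
          + ENNReal.ofReal (2 * M) * V B := by
        rw [show (k : ENNReal)⁻¹ * ((T.card + 1) * k * ∫⁻ z, h z.1.1 ∂Q)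
            = ((k : ENNReal)⁻¹ * k) * ((T.card + 1) * ∫⁻ z, h z.1.1 ∂Q) by ring,
          ENNReal.inv_mul_cancel hk0' (ENNReal.natCast_ne_top k)]
        ring

theorem tendsto_lintegral_enorm_knnAverage_sub (hU : ∀ c, Q (Prod.snd ⁻¹' {c}) = 0) {m : E → ℝ}
    (hm : IsRegression Q m) {k : ℕ → ℕ} (hk : Tendsto k atTop atTop)
    (hkn : Tendsto (fun n : ℕ => (k n : ℝ) / n) atTop (nhds 0)) :
    Tendsto (fun n => ∫⁻ q, ‖knnAverage (k n) q.2 q.1.1.1 - m q.1.1.1‖ₑ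
      ∂(Q.prod (Measure.pi fun _ : Fin n => Q))) atTop (nhds 0) := by
  obtain ⟨T, hT⟩ := exists_cone_cover E
  have hX : Measurable fun z : (E × Bool) × ℝ => z.1.1 := by fun_prop
  have : IsProbabilityMeasure (Q.map fun z => z.1.1) := Measure.isProbabilityMeasure_map hX.aemeasurable
  have hmi : Integrable m (Q.map fun z => z.1.1) :=
    Integrable.of_bound hm.measurable.aestronglyMeasurable 1 (.of_forall hm.abs_le_one)
  refine ENNReal.tendsto_nhds_zero.2 fun η hη => ?_
  obtain ⟨r, -, hr0, hrη⟩ := ENNReal.lt_iff_exists_real_btwn.1 hη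
  rw [ENNReal.ofReal_pos] at hr0
  set ε : ℝ := r / (2 * (T.card + 3)) with hε
  have hε0 : 0 < ε := by positivity
  obtain ⟨g, hgs, hgε, hgc, -⟩ :=
    hmi.exists_hasCompactSupport_lintegral_sub_le (ENNReal.ofReal_pos.2 hε0).ne'
  have hdm : Measurable fun x => ‖m x - g x‖ₑ := (hm.measurable.sub hgc.measurable).enorm
  rw [lintegral_map hdm hX] at hgε
  obtain ⟨M, hM⟩ := hgs.exists_bound_of_continuous hgc
  obtain ⟨δ, hδ, hgδ⟩ :=
    Metric.uniformContinuous_iff.1 (hgs.uniformContinuous_of_continuous hgc) ε hε0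
  have hsqrt : Tendsto (fun n => ENNReal.ofReal (5 / √(k n : ℝ))) atTop (nhds 0) := by
    rw [← ENNReal.ofReal_zero]
    exact ENNReal.tendsto_ofReal (Tendsto.const_div_atTop
      (Real.tendsto_sqrt_atTop.comp (tendsto_natCast_atTop_atTop.comp hk)) _)
  have hball := ENNReal.Tendsto.const_mul (a := ENNReal.ofReal (2 * M))
    (tendsto_prod_card_ball_lt (Q := Q) hkn hδ) (.inr ENNReal.ofReal_ne_top)
  have hsmall := hsqrt.add hball
  rw [mul_zero, add_zero] at hsmall
  filter_upwards [hk.eventually_gt_atTop 0, hkn.eventually_lt_const one_pos,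
    eventually_gt_atTop 0,
    ENNReal.tendsto_nhds_zero.1 hsmall _ (ENNReal.ofReal_pos.2 (half_pos hr0))]
    with n hn1 hn2 hn3 hn4
  have hkn' : k n ≤ n := by
    rw [div_lt_one (by exact_mod_cast hn3)] at hn2
    exact_mod_cast hn2.le
  refine (lintegral_enorm_knnAverage_sub_le hU hm hT hn1 hkn' hgc.measurable hM
    fun x y h => hgδ h).trans (le_trans ?_ hrη.le)
  calc _ ≤ ENNReal.ofReal (5 / √(k n)) + (T.card + 2) * ENNReal.ofReal ε + ENNReal.ofReal ε
        + ENNReal.ofReal (2 * M) * (Q.prod (Measure.pi fun _ : Fin n => Q))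
          {q | (Finset.univ.filter fun j : Fin n => dist q.1.1.1 (q.2 j).1.1 < δ).card < k n} := by
        gcongr
    _ = (ENNReal.ofReal (5 / √(k n)) + ENNReal.ofReal (2 * M)
          * (Q.prod (Measure.pi fun _ : Fin n => Q))
          {q | (Finset.univ.filter fun j : Fin n => dist q.1.1.1 (q.2 j).1.1 < δ).card < k n})
        + (T.card + 3) * ENNReal.ofReal ε := by ring
    _ ≤ ENNReal.ofReal (r / 2) + ENNReal.ofReal (r / 2) := by
        refine add_le_add hn4 (le_of_eq ?_)
        rw [show ((T.card : ENNReal) + 3) = ENNReal.ofReal (T.card + 3) by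
          rw [ENNReal.ofReal_add (by positivity) (by positivity)]; simp,
          ← ENNReal.ofReal_mul (by positivity)]
        congr 1
        rw [hε]
        field_simp
    _ = ENNReal.ofReal r := by
        rw [← ENNReal.ofReal_add (by positivity) (by positivity), add_halves]

end Consistency

section Risk

theorem bayesRisk_le_risk {X : Type*} [MeasurableSpace X] (P : Measure (X × Bool)) {f : X → Bool}
    (hf : Measurable f) : bayesRisk P ≤ risk P f :=
  ciInf_le (f := fun f : {f : X → Bool // Measurable f} => risk P (f : X → Bool))
    ⟨0, by rintro _ ⟨f, rfl⟩; exact ENNReal.toReal_nonneg⟩ ⟨f, hf⟩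

variable {X : Type*} [MeasurableSpace X] {P : Measure (X × Bool)} [IsProbabilityMeasure P]
  {ν : Measure ℝ} [IsProbabilityMeasure ν]

theorem risk_eq_integral {f : X → Bool} (hf : Measurable f) :
    risk P f = ∫ z, (1 - label (f z.1.1) * label z.1.2) / 2 ∂(P.prod ν) := by
  have hS : MeasurableSet {p : X × Bool | f p.1 ≠ p.2} :=
    (measurableSet_eq_fun (hf.comp measurable_fst) measurable_snd).compl
  have hm : Measurable fun p : X × Bool => (1 - label (f p.1) * label p.2) / 2 :=
    (((measurable_label.comp (hf.comp measurable_fst)).mul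
      (measurable_label.comp measurable_snd)).const_sub 1).div_const 2
  have h1 : risk P f = ∫ p, (1 - label (f p.1) * label p.2) / 2 ∂P := by
    change P.real _ = _
    rw [← integral_indicator_one hS]
    congr 1 with p
    by_cases h : f p.1 = p.2
    · simp only [ne_eq, Set.mem_ofPred_eq, h, not_true_eq_false, not_false_eq_true,
        Set.indicator_of_notMem]
      cases p.2 <;> norm_num [label]
    · rw [Set.indicator_of_mem (by simpa using h)]
      revert h
      cases p.2 <;> cases f p.1 <;> norm_num [label]
  rw [h1, integral_fun_fst (fun p : X × Bool => (1 - label (f p.1) * label p.2) / 2)]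
  simp

/-- A plug-in classifier has excess risk at most the `L¹` error of the plugged-in estimate. -/
theorem risk_plugin_le {m T : X → ℝ} (hm : IsRegression (P.prod ν) m) (hT : Measurable T)
    (hTi : Integrable (fun z => T z.1.1) (P.prod ν)) :
    risk P (fun x => decide (0 < T x)) ≤
      bayesRisk P + ∫ z, |T z.1.1 - m z.1.1| ∂(P.prod ν) := by
  set f : X → Bool := fun x => decide (0 < T x) with hfdef
  have hf : Measurable f := measurable_to_bool <| by
    simpa [f, Set.preimage] using measurableSet_lt measurable_const hT
  rw [← sub_le_iff_le_add]
  have : Nonempty {f : X → Bool // Measurable f} := ⟨⟨f, hf⟩⟩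
  refine le_ciInf fun ⟨g, hg⟩ => ?_
  rw [sub_le_iff_le_add, ← sub_le_iff_le_add', risk_eq_integral (ν := ν) hf,
    risk_eq_integral (ν := ν) hg]
  have hl : Measurable fun z : (X × Bool) × ℝ => label z.1.2 := measurable_label.comp (by fun_prop)
  have hlab : ∀ {h : X → Bool}, Measurable h →
      Measurable fun z : (X × Bool) × ℝ => label (h z.1.1) := fun hh =>
    measurable_label.comp (hh.comp (by fun_prop))
  have hi : ∀ {h : X → Bool}, Measurable h → Integrable
      (fun z : (X × Bool) × ℝ => (1 - label (h z.1.1) * label z.1.2) / 2) (P.prod ν) := fun {h} hh =>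
    Integrable.of_bound ((((hlab hh).mul hl).const_sub 1).div_const 2).aestronglyMeasurable 1 <|
      .of_forall fun z => by
        rw [Real.norm_eq_abs]
        cases z.1.2 <;> cases h z.1.1 <;> norm_num [label]
  let φ : X × ℝ → ℝ := fun w => (label (g w.1) - label (f w.1)) / 2
  have hφ : Measurable φ := ((measurable_label.comp (hg.comp measurable_fst)).sub
    (measurable_label.comp (hf.comp measurable_fst))).div_const 2
  have hφ1 : ∀ w, |φ w| ≤ 1 := fun w => by
    simp only [φ]
    cases g w.1 <;> cases f w.1 <;> norm_num [label]
  have hz := hm.integral_eq_zero φ 1 hφ hφ1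
  have hφz : Measurable fun z : (X × Bool) × ℝ => φ (z.1.1, z.2) := hφ.comp (by fun_prop)
  have hmz : Measurable fun z : (X × Bool) × ℝ => m z.1.1 := hm.measurable.comp (by fun_prop)
  have hi2 : Integrable (fun z : (X × Bool) × ℝ =>
      φ (z.1.1, z.2) * (label z.1.2 - m z.1.1)) (P.prod ν) :=
    Integrable.of_bound (hφz.mul (hl.sub hmz)).aestronglyMeasurable (1 * 2) <| .of_forall fun z => by
      rw [Real.norm_eq_abs, abs_mul]
      exact mul_le_mul (hφ1 _) (abs_label_sub_le hm.abs_le_one _ _) (abs_nonneg _) zero_le_one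
  have hmi : Integrable (fun z : (X × Bool) × ℝ => m z.1.1) (P.prod ν) :=
    Integrable.of_bound hmz.aestronglyMeasurable 1 (.of_forall fun z => hm.abs_le_one _)
  have hfg : Integrable (fun z : (X × Bool) × ℝ => (1 - label (f z.1.1) * label z.1.2) / 2
      - (1 - label (g z.1.1) * label z.1.2) / 2) (P.prod ν) := (hi hf).sub (hi hg)
  rw [← integral_sub (hi hf) (hi hg), ← sub_zero (∫ z, _ - _ ∂_), ← hz,
    ← integral_sub hfg hi2]
  refine integral_mono (hfg.sub hi2) (hTi.sub hmi).abs fun z => ?_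
  have hpt : (1 - label (f z.1.1) * label z.1.2) / 2 - (1 - label (g z.1.1) * label z.1.2) / 2
      - φ (z.1.1, z.2) * (label z.1.2 - m z.1.1)
      = (label (g z.1.1) - label (f z.1.1)) / 2 * m z.1.1 := by
    simp only [φ]; ring
  refine hpt.le.trans ?_
  simp only [hfdef]
  by_cases h : 0 < T z.1.1 <;> cases g z.1.1 <;> simp only [h, decide_true, decide_false, label] <;>
    norm_num <;> rw [le_abs] <;> [left; right] <;> linarith

end Risk


section Expectation

theorem measurable_risk {S X : Type*} [MeasurableSpace S] [MeasurableSpace X]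
    {P : Measure (X × Bool)} [IsProbabilityMeasure P] {f : S → X → Bool}
    (hf : Measurable fun q : S × X => f q.1 q.2) : Measurable fun s => risk P (f s) := by
  have hS : MeasurableSet {q : S × (X × Bool) | f q.1 q.2.1 ≠ q.2.2} :=
    (measurableSet_eq_fun (hf.comp (by fun_prop : Measurable fun q : S × (X × Bool) => (q.1, q.2.1)))
      (by fun_prop)).compl
  exact (measurable_measure_prodMk_left hS).ennreal_toReal

theorem integrable_risk {S X : Type*} [MeasurableSpace S] [MeasurableSpace X]
    {μ : Measure S} [IsFiniteMeasure μ] {P : Measure (X × Bool)} [IsProbabilityMeasure P]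
    {f : S → X → Bool} (hf : Measurable fun q : S × X => f q.1 q.2) :
    Integrable (fun s => risk P (f s)) μ :=
  Integrable.of_bound (measurable_risk hf).aestronglyMeasurable 1 <| .of_forall fun s => by
    rw [Real.norm_eq_abs, risk, abs_of_nonneg ENNReal.toReal_nonneg]
    exact measureReal_le_one

theorem abs_knnAverage_le {E : Type*} [MetricSpace E] {n : ℕ} (k : ℕ)
    (s : Fin n → (E × Bool) × ℝ) (x : E) : |knnAverage k s x| ≤ (k : ℝ)⁻¹ * n := by
  rw [knnAverage, abs_mul, abs_of_nonneg (by positivity : (0 : ℝ) ≤ (k : ℝ)⁻¹)]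
  gcongr
  refine (Finset.abs_sum_le_sum_abs _ _).trans ?_
  simp only [abs_label, Finset.sum_const, nsmul_eq_mul, mul_one]
  exact_mod_cast (Finset.card_le_univ _).trans_eq (Fintype.card_fin n)

variable {E : Type*} [MetricSpace E] [MeasurableSpace E] [BorelSpace E]
  [SecondCountableTopology E] {P : Measure (E × Bool)} [IsProbabilityMeasure P]
  {ν : Measure ℝ} [IsProbabilityMeasure ν]

theorem measurable_decide_knnAverage {Ω : Type*} [MeasurableSpace Ω] {n k : ℕ}
    {S : Ω → Fin n → (E × Bool) × ℝ} {x : Ω → E} (hS : Measurable S) (hx : Measurable x) :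
    Measurable fun ω => decide (0 < knnAverage k (S ω) (x ω)) :=
  measurable_to_bool <| by
    simpa [Set.preimage] using measurableSet_lt measurable_const (measurable_knnAverage hS hx)

theorem bayesRisk_le_integral_risk {n k : ℕ} :
    bayesRisk P ≤ ∫ s, risk P (fun x => decide (0 < knnAverage k s x))
      ∂(Measure.pi fun _ : Fin n => P.prod ν) := by
  have h : ∫ _, bayesRisk P ∂(Measure.pi fun _ : Fin n => P.prod ν) = bayesRisk P := by simp
  rw [← h]
  exact integral_mono (integrable_const _)
    (integrable_risk (measurable_decide_knnAverage measurable_fst measurable_snd))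
    fun s => bayesRisk_le_risk P (measurable_decide_knnAverage measurable_const measurable_id)

theorem integral_risk_le {m : E → ℝ} (hm : IsRegression (P.prod ν) m) {n k : ℕ} :
    ∫ s, risk P (fun x => decide (0 < knnAverage k s x))
        ∂(Measure.pi fun _ : Fin n => P.prod ν) ≤
      bayesRisk P + (∫⁻ q, ‖knnAverage k q.2 q.1.1.1 - m q.1.1.1‖ₑ
        ∂((P.prod ν).prod (Measure.pi fun _ : Fin n => P.prod ν))).toReal := by
  have hD : Integrable (fun q => knnAverage k q.2 q.1.1.1 - m q.1.1.1)
      ((P.prod ν).prod (Measure.pi fun _ : Fin n => P.prod ν)) := by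
    refine Integrable.of_bound
      ((measurable_knnAverage measurable_snd (by fun_prop)).sub
        (hm.measurable.comp (by fun_prop))).aestronglyMeasurable
      ((k : ℝ)⁻¹ * n + 1) (.of_forall fun q => ?_)
    exact (norm_sub_le _ _).trans (add_le_add (abs_knnAverage_le _ _ _) (hm.abs_le_one _))
  have hT : ∀ s : Fin n → (E × Bool) × ℝ, Measurable (knnAverage k s) := fun s =>
    measurable_knnAverage measurable_const measurable_id
  calc ∫ s, risk P (fun x => decide (0 < knnAverage k s x))
        ∂(Measure.pi fun _ : Fin n => P.prod ν)
      ≤ ∫ s, (bayesRisk P + ∫ z, |knnAverage k s z.1.1 - m z.1.1| ∂(P.prod ν))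
          ∂(Measure.pi fun _ : Fin n => P.prod ν) := by
        refine integral_mono (integrable_risk (measurable_decide_knnAverage measurable_fst measurable_snd))
          ((integrable_const _).add hD.abs.integral_prod_right) fun s => ?_
        refine risk_plugin_le hm (hT s) (Integrable.of_bound
          ((hT s).comp (by fun_prop)).aestronglyMeasurable _
          (.of_forall fun z => abs_knnAverage_le k s z.1.1))
    _ = bayesRisk P + ∫ s, ∫ z, |knnAverage k s z.1.1 - m z.1.1| ∂(P.prod ν)
          ∂(Measure.pi fun _ : Fin n => P.prod ν) := by
        rw [integral_add (integrable_const _) hD.abs.integral_prod_right]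
        simp
    _ = _ := by
        rw [← integral_norm_eq_lintegral_enorm hD.aestronglyMeasurable,
          integral_prod_symm _ hD.norm]
        rfl

theorem knnClassifier_eq_decide_knnAverage {d n k : ℕ} (hk : 0 < k)
    (s : Fin n → (EuclideanSpace ℝ (Fin d) × Bool) × ℝ) :
    knnClassifier k s = fun x => decide (0 < knnAverage k s x) := by
  funext x
  have hlabel : ∀ b : Bool, label b = ((if b then (1 : ℤ) else -1 : ℤ) : ℝ) := by
    intro b; cases b <;> simp [label]
  have hk' : (0 : ℝ) < (k : ℝ)⁻¹ := by positivity
  rw [knnClassifier, knnAverage, decide_eq_decide, mul_pos_iff_of_pos_left hk']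
  simp_rw [hlabel]
  rw [← Int.cast_sum, Int.cast_pos]
  rfl

end Expectation

/-- **Stone's theorem: universal Bayes-consistency of the k-nearest neighbor rule.** Let `P` be
any probability distribution on `ℝ^d × {−1,+1}` and `k_n → ∞` with `k_n / n → 0`. The sample
points carry independent auxiliary `Uniform[0,1]` variables used for tie-breaking. Then the
expected risk of the `k_n`-nearest neighbor classifier converges to the Bayes risk of `P`. -/
theorem stone_knn_universally_consistent (d : ℕ)
    (P : Measure (EuclideanSpace ℝ (Fin d) × Bool)) [IsProbabilityMeasure P]
    (k : ℕ → ℕ) (hk : Tendsto k atTop atTop)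
    (hkn : Tendsto (fun n : ℕ => (k n : ℝ) / n) atTop (nhds 0)) :
    Tendsto (fun n : ℕ =>
        ∫ s, risk P (knnClassifier (k n) s)
          ∂(Measure.pi fun _ : Fin n => P.prod (volume.restrict (Set.Icc (0 : ℝ) 1))))
      atTop (nhds (bayesRisk P)) := by
  set ν : Measure ℝ := volume.restrict (Set.Icc (0 : ℝ) 1)
  have : IsProbabilityMeasure ν := ⟨by simp [ν]⟩
  have hU : ∀ c, (P.prod ν) (Prod.snd ⁻¹' {c}) = 0 := fun c => by
    rw [← Set.univ_prod, Measure.prod_prod, measure_singleton, mul_zero]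
  obtain ⟨m, hm⟩ := exists_isRegression_prod P ν
  have herr := (ENNReal.tendsto_toReal ENNReal.zero_ne_top).comp
    (tendsto_lintegral_enorm_knnAverage_sub hU hm hk hkn)
  have hlim := herr.const_add (bayesRisk P)
  rw [ENNReal.toReal_zero, add_zero] at hlim
  have hpos := hk.eventually_gt_atTop 0
  refine tendsto_of_tendsto_of_tendsto_of_le_of_le' tendsto_const_nhds hlim ?_ ?_
  · filter_upwards [hpos] with n hn
    simp_rw [knnClassifier_eq_decide_knnAverage hn]
    exact bayesRisk_le_integral_risk
  · filter_upwards [hpos] with n hn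
    simp_rw [knnClassifier_eq_decide_knnAverage hn]
    exact integral_risk_le hm
end

section
/- Let x_1, …, x_m be points in ℝ^d with ‖x_i‖ ≤ R for all i, and let ρ > 0. Suppose the set {x_1, …, x_m} is shattered by hyperplanes with margin at least ρ: for every labeling (y_1, …, y_m) ∈ {−1, +1}^m there exist w ∈ ℝ^d with ‖w‖ = 1 and b ∈ ℝ such that y_i·(⟨w, x_i⟩ + b) ≥ ρ for all i. Then m ≤ min{d, 4R²/ρ²} + 1. Equivalently, the VC dimension of the class of linear classifiers with margin at least ρ on data contained in the ball of radius R in ℝ^d is at most min{d, 4R²/ρ²} + 1. -/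
open scoped RealInnerProductSpace

/-- Signs can be chosen so that the signed sum of vectors is no longer than it would be if the
vectors were orthogonal. -/
theorem exists_sign_norm_sum_sq_le {ι E : Type*} [NormedAddCommGroup E] [InnerProductSpace ℝ E]
    (z : ι → E) (t : Finset ι) :
    ∃ s : ι → ℝ, (∀ i, s i = 1 ∨ s i = -1) ∧
      ‖∑ i ∈ t, s i • z i‖ ^ 2 ≤ ∑ i ∈ t, ‖z i‖ ^ 2 := by
  classical
  induction t using Finset.induction_on with
  | empty => exact ⟨fun _ => 1, by simp, by simp⟩
  | insert a t ha ih =>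
    obtain ⟨s, hs, hle⟩ := ih
    obtain ⟨e, he, hinner⟩ : ∃ e : ℝ, (e = 1 ∨ e = -1) ∧
        e * ⟪z a, ∑ i ∈ t, s i • z i⟫ ≤ 0 := by
      rcases le_total ⟪z a, ∑ i ∈ t, s i • z i⟫ 0 with h | h
      · exact ⟨1, by simp, by linarith⟩
      · exact ⟨-1, by simp, by linarith⟩
    refine ⟨Function.update s a e, fun i => ?_, ?_⟩
    · by_cases h : i = a
      · subst h; simpa using he
      · simpa [h] using hs i
    · have hsum : ∑ i ∈ t, Function.update s a e i • z i = ∑ i ∈ t, s i • z i :=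
        Finset.sum_congr rfl fun i hi => by
          rw [Function.update_of_ne (ne_of_mem_of_not_mem hi ha)]
      rw [Finset.sum_insert ha, Finset.sum_insert ha, hsum, Function.update_self,
        norm_add_sq_real, real_inner_smul_left]
      have hnorm : ‖e • z a‖ = ‖z a‖ := by
        rcases he with rfl | rfl <;> simp
      rw [hnorm]
      linarith

/-- Points on which every labeling is realized by a hyperplane with a positive margin are
affinely independent. -/
theorem affineIndependent_of_forall_margin {ι E : Type*} [NormedAddCommGroup E]
    [InnerProductSpace ℝ E] {ρ : ℝ} (hρ : 0 < ρ) (x : ι → E)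
    (hshatter : ∀ y : ι → ℝ, (∀ i, y i = 1 ∨ y i = -1) →
      ∃ (w : E) (b : ℝ), ∀ i, ρ ≤ y i * (⟪w, x i⟫ + b)) :
    AffineIndependent ℝ x := by
  rw [affineIndependent_iff]
  intro t c hc hcx
  obtain ⟨w, b, h⟩ := hshatter (fun i => if 0 ≤ c i then 1 else -1) fun i => by
    by_cases hi : 0 ≤ c i <;> simp [hi]
  have hle : ∀ i, |c i| * ρ ≤ c i * (⟪w, x i⟫ + b) := fun i => by
    have hi := mul_le_mul_of_nonneg_left (h i) (abs_nonneg (c i))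
    by_cases h0 : 0 ≤ c i
    · simpa [h0, abs_of_nonneg] using hi
    · simp only [h0, if_false] at hi
      rw [abs_of_neg (not_le.1 h0)] at hi ⊢
      linarith
  have hzero : ∑ i ∈ t, c i * (⟪w, x i⟫ + b) = 0 := by
    have hw : ∑ i ∈ t, c i * ⟪w, x i⟫ = 0 := by
      simpa [inner_sum, real_inner_smul_right] using congrArg (fun v => ⟪w, v⟫) hcx
    simp_rw [mul_add, Finset.sum_add_distrib]
    rw [← Finset.sum_mul, hw, hc]
    simp
  have habs : ∑ i ∈ t, |c i| * ρ = 0 :=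
    le_antisymm (hzero ▸ Finset.sum_le_sum fun i _ => hle i)
      (Finset.sum_nonneg fun i _ => by positivity)
  intro i hi
  have := (Finset.sum_eq_zero_iff_of_nonneg fun i _ => by positivity).1 habs i hi
  simpa [hρ.ne'] using this

/-- If all labelings of `x` that give opposite labels to the members of each of `k` pairs have
margin at least `ρ`, then `k ≤ R² / ρ²`. -/
theorem card_pairs_mul_sq_le {E : Type*} [NormedAddCommGroup E] [InnerProductSpace ℝ E]
    {R ρ : ℝ} (hρ : 0 < ρ) (k : ℕ) (u v : ℕ → E)
    (hu : ∀ j < k, ‖u j‖ ≤ R) (hv : ∀ j < k, ‖v j‖ ≤ R)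
    (h : ∀ s : ℕ → ℝ, (∀ j, s j = 1 ∨ s j = -1) → ∃ (w : E) (b : ℝ), ‖w‖ = 1 ∧
      ∀ j < k, ρ ≤ s j * (⟪w, u j⟫ + b) ∧ ρ ≤ -s j * (⟪w, v j⟫ + b)) :
    k * ρ ^ 2 ≤ R ^ 2 := by
  rcases Nat.eq_zero_or_pos k with rfl | hk
  · simpa using sq_nonneg R
  obtain ⟨s, hs, hle⟩ := exists_sign_norm_sum_sq_le (fun j => u j - v j) (Finset.range k)
  obtain ⟨w, b, hw, hm⟩ := h s hs
  have hlower : k * (2 * ρ) ≤ ‖∑ j ∈ Finset.range k, s j • (u j - v j)‖ := by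
    calc k * (2 * ρ) = ∑ _j ∈ Finset.range k, 2 * ρ := by simp
      _ ≤ ∑ j ∈ Finset.range k, ⟪w, s j • (u j - v j)⟫ := by
          refine Finset.sum_le_sum fun j hj => ?_
          obtain ⟨h1, h2⟩ := hm j (Finset.mem_range.1 hj)
          rw [real_inner_smul_right, inner_sub_right]
          linarith
      _ = ⟪w, ∑ j ∈ Finset.range k, s j • (u j - v j)⟫ := (inner_sum _ _ _).symm
      _ ≤ ‖w‖ * ‖∑ j ∈ Finset.range k, s j • (u j - v j)‖ := real_inner_le_norm _ _
      _ = _ := by rw [hw, one_mul]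
  have hupper : ∑ j ∈ Finset.range k, ‖u j - v j‖ ^ 2 ≤ k * (2 * R) ^ 2 := by
    calc _ ≤ ∑ _j ∈ Finset.range k, (2 * R) ^ 2 := by
          refine Finset.sum_le_sum fun j hj => ?_
          have hj := Finset.mem_range.1 hj
          have : ‖u j - v j‖ ≤ 2 * R := by
            linarith [norm_sub_le (u j) (v j), hu j hj, hv j hj]
          gcongr
      _ = _ := by simp
  have hsq : (k * (2 * ρ)) ^ 2 ≤ k * (2 * R) ^ 2 :=
    (pow_le_pow_left₀ (by positivity) hlower 2).trans (hle.trans hupper)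
  have hk' : (0 : ℝ) < 4 * k := by positivity
  refine le_of_mul_le_mul_left ?_ hk'
  linarith

/-- **VC dimension bound for large-margin hyperplanes.** If `x_1, …, x_m ∈ ℝ^d` with
`‖x_i‖ ≤ R` are shattered by hyperplanes with margin at least `ρ` — i.e. for every
`±1`-labeling `y` there are `w` with `‖w‖ = 1` and `b ∈ ℝ` such that
`y_i (⟨w, x_i⟩ + b) ≥ ρ` for all `i` — then `m ≤ min {d, 4R²/ρ²} + 1`. -/
theorem margin_vc_bound {d m : ℕ} (R ρ : ℝ) (hρ : 0 < ρ)
    (x : Fin m → EuclideanSpace ℝ (Fin d)) (hR : ∀ i, ‖x i‖ ≤ R)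
    (hshatter : ∀ y : Fin m → ℝ, (∀ i, y i = 1 ∨ y i = -1) →
      ∃ (w : EuclideanSpace ℝ (Fin d)) (b : ℝ), ‖w‖ = 1 ∧
        ∀ i, ρ ≤ y i * (⟪w, x i⟫ + b)) :
    (m : ℝ) ≤ min (d : ℝ) (4 * R ^ 2 / ρ ^ 2) + 1 := by
  have hdim : m ≤ d + 1 := by
    have hx : AffineIndependent ℝ x := affineIndependent_of_forall_margin hρ x fun y hy =>
      let ⟨w, b, _, h⟩ := hshatter y hy
      ⟨w, b, h⟩
    have hcard := hx.card_le_finrank_succ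
    have hspan := Submodule.finrank_le (vectorSpan ℝ (Set.range x))
    simp only [Fintype.card_fin, finrank_euclideanSpace] at hcard hspan
    omega
  have hmargin : ((m / 2 : ℕ) : ℝ) * ρ ^ 2 ≤ R ^ 2 := by
    let x' : ℕ → EuclideanSpace ℝ (Fin d) := fun n => if h : n < m then x ⟨n, h⟩ else 0
    have hx' : ∀ n (h : n < m), x' n = x ⟨n, h⟩ := fun n h => dif_pos h
    refine card_pairs_mul_sq_le hρ (m / 2) (fun j => x' (2 * j)) (fun j => x' (2 * j + 1))
      (fun j hj => ?_) (fun j hj => ?_) fun s hs => ?_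
    · rw [hx' _ (by omega)]
      exact hR _
    · rw [hx' _ (by omega)]
      exact hR _
    · obtain ⟨w, b, hw, h⟩ := hshatter
        (fun i => if (i : ℕ) % 2 = 0 then s (i / 2) else -s (i / 2)) fun i => by
          rcases hs (i / 2) with h | h <;> by_cases hi : (i : ℕ) % 2 = 0 <;> simp [h, hi]
      refine ⟨w, b, hw, fun j hj => ⟨?_, ?_⟩⟩
      · simpa [hx' (2 * j) (by omega)] using h ⟨2 * j, by omega⟩
      · have hdiv : (2 * j + 1) / 2 = j := by omega
        have hmod : (2 * j + 1) % 2 ≠ 0 := by omega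
        simpa only [hx' (2 * j + 1) (by omega), hdiv, hmod, if_false]
          using h ⟨2 * j + 1, by omega⟩
  have hm : (m : ℝ) ≤ 2 * ((m / 2 : ℕ) : ℝ) + 1 := by
    exact_mod_cast (by omega : m ≤ 2 * (m / 2) + 1)
  have hd : (m : ℝ) ≤ d + 1 := by exact_mod_cast hdim
  rw [← sub_le_iff_le_add]
  refine le_min (by linarith) ?_
  rw [le_div_iff₀ (by positivity)]
  nlinarith [sq_nonneg R, mul_le_mul_of_nonneg_right hm (sq_nonneg ρ)]
end
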